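/- arXiv:1606.06000 — 2 statements merged into one kernel-verified Lean document; each statement's English description precedes it below -/
import Mathlib

section
/- Let N ≥ 1, L ≥ 0 and n ≥ N be integers and set K_N = π^{−2N²} ∏_{j=1}^{N} Γ(2j) Γ(2(n+L+j)) / (Γ(2(L+j)) Γ(2(n−N+j))). Then K_N ∫ det(G G*)^{L} / det(1_{2N} + G G*)^{n+N+L} dG = 1, where the integral is over all N×N real quaternion matrices G in their 2N×2N complex representation. (This is the normalization of the matrix probability density of the real quaternion (β = 4) induced spherical ensemble.) -/
open MeasureTheory Matrix

/-- The `2N × 2N` complex representation of an `N × N` real quaternion matrix with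
quaternion entries parametrized by `(w, x) ∈ ℂ^{N×N} × ℂ^{N×N}`: the `(j,k)` block is
`[[w j k, x j k], [-conj (x j k), conj (w j k)]]`. -/
noncomputable def quatMat (N : ℕ) (w x : Fin N → Fin N → ℂ) :
    Matrix (Fin N × Fin 2) (Fin N × Fin 2) ℂ :=
  Matrix.of fun jp kq =>
    !![w jp.1 kq.1, x jp.1 kq.1;
       -(starRingEnd ℂ) (x jp.1 kq.1), (starRingEnd ℂ) (w jp.1 kq.1)] jp.2 kq.2

section

open scoped Quaternion ENNReal

section

/-- The `2 × 2` complex block representation of a matrix of real quaternions. -/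
noncomputable def quatRep {m n : Type*} (X : Matrix m n ℍ[ℝ]) :
    Matrix (m × Fin 2) (n × Fin 2) ℂ :=
  Matrix.of fun i j =>
    !![⟨(X i.1 j.1).re, (X i.1 j.1).imI⟩, ⟨(X i.1 j.1).imJ, (X i.1 j.1).imK⟩;
       -(starRingEnd ℂ) ⟨(X i.1 j.1).imJ, (X i.1 j.1).imK⟩,
       (starRingEnd ℂ) ⟨(X i.1 j.1).re, (X i.1 j.1).imI⟩] i.2 j.2

section Rep
variable {l m n : Type*}

theorem quatRep_mul [Fintype m] (X : Matrix l m ℍ[ℝ]) (Y : Matrix m n ℍ[ℝ]) :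
    quatRep (X * Y) = quatRep X * quatRep Y := by
  have hre : ∀ f : m → ℍ[ℝ], (∑ i, f i).re = ∑ i, (f i).re := fun f =>
    map_sum (⟨⟨fun q : ℍ[ℝ] => q.re, rfl⟩, fun _ _ => rfl⟩ : ℍ[ℝ] →+ ℝ) f _
  have hI : ∀ f : m → ℍ[ℝ], (∑ i, f i).imI = ∑ i, (f i).imI := fun f =>
    map_sum (⟨⟨fun q : ℍ[ℝ] => q.imI, rfl⟩, fun _ _ => rfl⟩ : ℍ[ℝ] →+ ℝ) f _
  have hJ : ∀ f : m → ℍ[ℝ], (∑ i, f i).imJ = ∑ i, (f i).imJ := fun f =>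
    map_sum (⟨⟨fun q : ℍ[ℝ] => q.imJ, rfl⟩, fun _ _ => rfl⟩ : ℍ[ℝ] →+ ℝ) f _
  have hK : ∀ f : m → ℍ[ℝ], (∑ i, f i).imK = ∑ i, (f i).imK := fun f =>
    map_sum (⟨⟨fun q : ℍ[ℝ] => q.imK, rfl⟩, fun _ _ => rfl⟩ : ℍ[ℝ] →+ ℝ) f _
  ext ⟨i, a⟩ ⟨j, b⟩
  simp only [quatRep, Matrix.of_apply, Matrix.mul_apply, Fintype.sum_prod_type,
    Fin.sum_univ_two]
  fin_cases a <;> fin_cases b <;>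
  · apply Complex.ext <;>
    · simp [hre, hI, hJ, hK, ← Finset.sum_neg_distrib]
      try simp only [← Finset.sum_sub_distrib]
      try (refine Finset.sum_congr rfl fun k _ => ?_; ring)

theorem quatRep_conjTranspose (X : Matrix m n ℍ[ℝ]) : quatRep Xᴴ = (quatRep X)ᴴ := by
  ext ⟨i, a⟩ ⟨j, b⟩
  fin_cases a <;> fin_cases b <;> apply Complex.ext <;> simp [quatRep]

theorem conjTranspose_real_smul (r : ℝ) (X : Matrix m n ℍ[ℝ]) : (r • X)ᴴ = r • Xᴴ := by
  ext i j <;> simp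

theorem quatRep_add (X Y : Matrix m n ℍ[ℝ]) : quatRep (X + Y) = quatRep X + quatRep Y := by
  ext ⟨i, a⟩ ⟨j, b⟩
  fin_cases a <;> fin_cases b <;> apply Complex.ext <;> simp [quatRep] <;> ring

theorem quatRep_smul (r : ℝ) (X : Matrix m n ℍ[ℝ]) : quatRep (r • X) = r • quatRep X := by
  ext ⟨i, a⟩ ⟨j, b⟩
  fin_cases a <;> fin_cases b <;> apply Complex.ext <;> simp [quatRep]

theorem quatRep_one [DecidableEq m] : quatRep (1 : Matrix m m ℍ[ℝ]) = 1 := by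
  ext ⟨i, a⟩ ⟨j, b⟩
  by_cases h : i = j
  · subst h
    fin_cases a <;> fin_cases b <;> apply Complex.ext <;> simp [quatRep, Matrix.one_apply]
  · fin_cases a <;> fin_cases b <;> apply Complex.ext <;> simp [quatRep, Matrix.one_apply, h]

theorem quatRep_zero : quatRep (0 : Matrix m n ℍ[ℝ]) = 0 := by
  ext ⟨i, a⟩ ⟨j, b⟩
  fin_cases a <;> fin_cases b <;> apply Complex.ext <;> simp [quatRep]

theorem quatRep_fromBlocks {o p : Type*} (A : Matrix m n ℍ[ℝ]) (B : Matrix m p ℍ[ℝ])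
    (C : Matrix o n ℍ[ℝ]) (D : Matrix o p ℍ[ℝ]) :
    quatRep (fromBlocks A B C D) =
      (fromBlocks (quatRep A) (quatRep B) (quatRep C) (quatRep D)).submatrix
        (Equiv.sumProdDistrib m o (Fin 2)) (Equiv.sumProdDistrib n p (Fin 2)) := by
  ext ⟨i | i, a⟩ ⟨j | j, b⟩ <;> rfl

/-- The absolute value of the determinant of the complex representation. -/
noncomputable def quatDet [Fintype n] [DecidableEq n] (X : Matrix n n ℍ[ℝ]) : ℝ :=
  ‖(quatRep X).det‖

variable [Fintype n] [DecidableEq n] [Fintype m] [DecidableEq m]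

theorem quatDet_nonneg (X : Matrix n n ℍ[ℝ]) : 0 ≤ quatDet X := norm_nonneg _

theorem quatDet_mul (X Y : Matrix n n ℍ[ℝ]) : quatDet (X * Y) = quatDet X * quatDet Y := by
  simp [quatDet, quatRep_mul]

theorem quatDet_one : quatDet (1 : Matrix n n ℍ[ℝ]) = 1 := by
  simp [quatDet, quatRep_one]

theorem quatDet_conjTranspose (X : Matrix n n ℍ[ℝ]) : quatDet Xᴴ = quatDet X := by
  simp [quatDet, quatRep_conjTranspose, Matrix.det_conjTranspose]

theorem quatDet_submatrix (e : m ≃ n) (X : Matrix n n ℍ[ℝ]) :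
    quatDet (X.submatrix e e) = quatDet X := by
  have : quatRep (X.submatrix e e) =
      (quatRep X).submatrix (e.prodCongr (Equiv.refl (Fin 2)))
        (e.prodCongr (Equiv.refl (Fin 2))) := rfl
  rw [quatDet, this, Matrix.det_submatrix_equiv_self, quatDet]

theorem quatDet_smul_one (r : ℝ) :
    quatDet (r • (1 : Matrix n n ℍ[ℝ])) = (r ^ 2) ^ Fintype.card n := by
  rw [quatDet, quatRep_smul, quatRep_one, ← Complex.coe_smul, Matrix.det_smul]
  simp [mul_comm _ 2, pow_mul]

theorem quatDet_unit (X : Matrix Unit Unit ℍ[ℝ]) :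
    quatDet X = Quaternion.normSq (X () ()) := by
  rw [quatDet, ← Matrix.det_submatrix_equiv_self (Equiv.uniqueProd (Fin 2) Unit).symm,
    Matrix.det_fin_two]
  have : (quatRep X).submatrix (Equiv.uniqueProd (Fin 2) Unit).symm
      (Equiv.uniqueProd (Fin 2) Unit).symm 0 0 *
      (quatRep X).submatrix (Equiv.uniqueProd (Fin 2) Unit).symm
      (Equiv.uniqueProd (Fin 2) Unit).symm 1 1 -
      (quatRep X).submatrix (Equiv.uniqueProd (Fin 2) Unit).symm
      (Equiv.uniqueProd (Fin 2) Unit).symm 0 1 *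
      (quatRep X).submatrix (Equiv.uniqueProd (Fin 2) Unit).symm
      (Equiv.uniqueProd (Fin 2) Unit).symm 1 0 = ((Quaternion.normSq (X () ()) : ℝ) : ℂ) := by
    apply Complex.ext
    · rw [Complex.ofReal_re, Quaternion.normSq_def']
      simp [quatRep]
      ring
    · simp [quatRep]; ring
  rw [this, Complex.norm_real, Real.norm_of_nonneg Quaternion.normSq_nonneg]

theorem quatDet_fromBlocks_zero₁₂ (A : Matrix m m ℍ[ℝ]) (C : Matrix n m ℍ[ℝ])
    (D : Matrix n n ℍ[ℝ]) :
    quatDet (fromBlocks A 0 C D) = quatDet A * quatDet D := by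
  rw [quatDet, quatRep_fromBlocks, Matrix.det_submatrix_equiv_self, quatRep_zero,
    Matrix.det_fromBlocks_zero₁₂, norm_mul, quatDet, quatDet]

/-- Schur complement of a scalar diagonal block. -/
theorem quatDet_fromBlocks_smul_one {r : ℝ} (hr : r ≠ 0) (B : Matrix m n ℍ[ℝ])
    (C : Matrix n m ℍ[ℝ]) (D : Matrix n n ℍ[ℝ]) :
    quatDet (fromBlocks (r • 1) B C D) =
      (r ^ 2) ^ Fintype.card m * quatDet (D - r⁻¹ • (C * B)) := by
  have h : fromBlocks (r • 1) B C D * fromBlocks 1 (-(r⁻¹ • B)) 0 1 =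
      fromBlocks (r • 1) 0 C (D - r⁻¹ • (C * B)) := by
    rw [Matrix.fromBlocks_multiply]
    congr 1 <;> simp [smul_smul, hr, sub_eq_neg_add]
  have h2 : quatDet (fromBlocks (1 : Matrix m m ℍ[ℝ]) (-(r⁻¹ • B)) 0 (1 : Matrix n n ℍ[ℝ]))
      = 1 := by
    rw [← quatDet_conjTranspose, Matrix.fromBlocks_conjTranspose]
    simp [quatDet_fromBlocks_zero₁₂, quatDet_one]
  rw [← quatDet_smul_one, ← quatDet_fromBlocks_zero₁₂ (r • 1) C, ← h, quatDet_mul, h2, mul_one]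

theorem det_quatRep_mul_conjTranspose (X : Matrix n n ℍ[ℝ]) :
    (quatRep X * (quatRep X)ᴴ).det = ((quatDet X ^ 2 : ℝ) : ℂ) := by
  rw [Matrix.det_mul, Matrix.det_conjTranspose, quatDet]
  simpa using Complex.mul_conj' _

open scoped ComplexOrder in
theorem det_one_add_quatRep_mul_conjTranspose (X : Matrix n n ℍ[ℝ]) :
    (1 + quatRep X * (quatRep X)ᴴ).det = ((quatDet (1 + X * Xᴴ) : ℝ) : ℂ) ∧
      0 < quatDet (1 + X * Xᴴ) := by
  have h : (1 + quatRep X * (quatRep X)ᴴ).PosDef :=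
    Matrix.PosDef.one.add_posSemidef (Matrix.posSemidef_self_mul_conjTranspose _)
  have h2 := h.det_pos
  have h3 : quatDet (1 + X * Xᴴ) = ‖(1 + quatRep X * (quatRep X)ᴴ).det‖ := by
    rw [quatDet, quatRep_add, quatRep_mul, quatRep_conjTranspose, quatRep_one]
  rw [h3]
  exact ⟨(Complex.eq_coe_norm_of_nonneg h2.le), norm_pos_iff.2 h2.ne'⟩

end Rep

section Vec
variable {n : Type*} [Fintype n]

/-- The squared norm of a quaternion vector. -/
def vecNormSq (v : n → ℍ[ℝ]) : ℝ := ∑ i, Quaternion.normSq (v i)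

theorem vecNormSq_nonneg (v : n → ℍ[ℝ]) : 0 ≤ vecNormSq v :=
  Finset.sum_nonneg fun _ _ => Quaternion.normSq_nonneg

theorem row_mul_conjTranspose (v : Matrix Unit n ℍ[ℝ]) :
    v * vᴴ = vecNormSq (v ()) • (1 : Matrix Unit Unit ℍ[ℝ]) := by
  ext1 i j
  simp [Matrix.mul_apply, vecNormSq, Quaternion.self_mul_star, Algebra.smul_def]

theorem conjTranspose_mul_col (b : Matrix n Unit ℍ[ℝ]) :
    bᴴ * b = vecNormSq (fun i => b i ()) • (1 : Matrix Unit Unit ℍ[ℝ]) := by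
  ext1 i j
  simp [Matrix.mul_apply, vecNormSq, Quaternion.star_mul_self, Algebra.smul_def]

theorem quatDet_one_add_col [DecidableEq n] (b : Matrix n Unit ℍ[ℝ]) :
    quatDet (1 + b * bᴴ) = (1 + vecNormSq fun i => b i ()) ^ 2 := by
  have : quatDet (1 + b * bᴴ) = quatDet (1 + bᴴ * b) := by
    simp only [quatDet, quatRep_add, quatRep_mul, quatRep_one]
    rw [Matrix.det_one_add_mul_comm]
  rw [this, conjTranspose_mul_col]
  nth_rewrite 1 [← one_smul ℝ (1 : Matrix Unit Unit ℍ[ℝ])]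
  rw [← add_smul, quatDet_smul_one]
  simp

end Vec

/-- A Householder reflection moving a row vector onto a coordinate axis. -/
theorem exists_householder {n : Type*} [Fintype n] [DecidableEq n] (o : n)
    (v : Matrix Unit n ℍ[ℝ]) :
    ∃ (H : Matrix n n ℍ[ℝ]) (q : ℍ[ℝ]), H * H = 1 ∧ Hᴴ = H ∧
      v * H = Matrix.of (fun _ j => if j = o then q else 0) ∧
      Quaternion.normSq q = vecNormSq (v ()) := by
  set r := vecNormSq (v ()) with hr
  have hr0 : 0 ≤ r := vecNormSq_nonneg _
  obtain ⟨u, hu, hua⟩ : ∃ u : ℍ[ℝ], Quaternion.normSq u = 1 ∧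
      u * star (v () o) = ((‖v () o‖ : ℝ) : ℍ[ℝ]) := by
    by_cases h : v () o = 0
    · exact ⟨1, by simp, by simp [h]⟩
    · have h' : ‖v () o‖ ≠ 0 := norm_ne_zero_iff.2 h
      refine ⟨(‖v () o‖⁻¹ : ℝ) • v () o, ?_, ?_⟩
      · rw [Quaternion.normSq_smul, Quaternion.normSq_eq_norm_mul_self]
        field_simp
      · rw [smul_mul_assoc, Quaternion.self_mul_star, Quaternion.normSq_eq_norm_mul_self,
          ← Quaternion.coe_smul]
        congr 1
        simp [h']
  have hau : v () o * star u = ((‖v () o‖ : ℝ) : ℍ[ℝ]) := by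
    have := congrArg star hua
    simpa using this
  set e : Matrix Unit n ℍ[ℝ] := Matrix.of fun _ j => if j = o then (√r : ℝ) • u else 0 with he
  have hev : e * vᴴ = (√r * ‖v () o‖) • (1 : Matrix Unit Unit ℍ[ℝ]) := by
    ext1 i j
    obtain rfl : i = () := rfl
    simp [he, Matrix.mul_apply, hua, Algebra.smul_def, mul_assoc]
  have hve : v * eᴴ = (√r * ‖v () o‖) • (1 : Matrix Unit Unit ℍ[ℝ]) := by
    have := congrArg conjTranspose hev
    simpa [Matrix.conjTranspose_mul, conjTranspose_real_smul] using this
  have hee : e * eᴴ = r • (1 : Matrix Unit Unit ℍ[ℝ]) := by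
    ext1 i j
    simp [he, Matrix.mul_apply, Quaternion.self_mul_star, hu, smul_smul, Real.mul_self_sqrt hr0]
  have hvv : v * vᴴ = r • (1 : Matrix Unit Unit ℍ[ℝ]) := row_mul_conjTranspose v
  have hq : Quaternion.normSq ((√r : ℝ) • u) = r := by
    rw [Quaternion.normSq_smul, hu, mul_one, Real.sq_sqrt hr0]
  set ρ := r - √r * ‖v () o‖ with hρ
  set y := v - e with hy
  have hvy : v * yᴴ = ρ • (1 : Matrix Unit Unit ℍ[ℝ]) := by
    rw [hy, conjTranspose_sub, Matrix.mul_sub, hvv, hve, ← sub_smul]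
  have hyy : y * yᴴ = (2 * ρ) • (1 : Matrix Unit Unit ℍ[ℝ]) := by
    rw [hy, conjTranspose_sub, Matrix.mul_sub, Matrix.sub_mul, Matrix.sub_mul, hvv, hve, hee, hev,
      ← sub_smul, ← sub_smul, ← sub_smul]
    congr 1
    ring
  by_cases h0 : ρ = 0
  · refine ⟨1, (√r : ℝ) • u, by simp, by simp, ?_, hq⟩
    have h1 : vecNormSq (y ()) = 0 := by
      have := hyy.symm.trans (row_mul_conjTranspose y)
      have := congrFun (congrFun this ()) ()
      have := congrArg (fun q : ℍ[ℝ] => q.re) this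
      simpa [h0, eq_comm] using this
    have h2 : ∀ j, y () j = 0 := fun j => by
      have := (Finset.sum_eq_zero_iff_of_nonneg
        (fun _ _ => Quaternion.normSq_nonneg)).1 h1 j (Finset.mem_univ _)
      simpa using this
    rw [Matrix.mul_one]
    have : v = e := by
      ext1 i j
      exact sub_eq_zero.1 (h2 j)
    rw [this]
  · refine ⟨1 - ρ⁻¹ • (yᴴ * y), (√r : ℝ) • u, ?_, ?_, ?_, hq⟩
    · have h1 : (yᴴ * y) * (yᴴ * y) = (2 * ρ) • (yᴴ * y) := by
        rw [Matrix.mul_assoc, ← Matrix.mul_assoc y, hyy]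
        simp
      rw [Matrix.mul_sub, Matrix.sub_mul, Matrix.sub_mul, Matrix.one_mul, Matrix.mul_one,
        Matrix.one_mul, smul_mul_smul_comm, h1, smul_smul, sub_sub, sub_eq_self, ← sub_smul,
        ← add_smul]
      convert zero_smul ℝ _ using 2
      field_simp
      ring
    · simp [Matrix.conjTranspose_mul, conjTranspose_real_smul]
    · rw [Matrix.mul_sub, Matrix.mul_smul, ← Matrix.mul_assoc, hvy, Matrix.mul_one]
      simp [smul_smul, h0, hy]
      rfl

end

section

/-- The real-linear coordinates `w + x j` of a quaternion. -/
noncomputable def quatOfComplexPair : (ℂ × ℂ) ≃ₗ[ℝ] ℍ[ℝ] where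
  toFun p := ⟨p.1.re, p.1.im, p.2.re, p.2.im⟩
  invFun q := (⟨q.re, q.imI⟩, ⟨q.imJ, q.imK⟩)
  map_add' p q := by ext <;> rfl
  map_smul' r p := by ext <;> simp <;> rfl
  left_inv p := rfl
  right_inv q := rfl

noncomputable instance : MeasurableSpace ℍ[ℝ] := borel _

instance : BorelSpace ℍ[ℝ] := ⟨rfl⟩

/-- Lebesgue measure in the four real coordinates. -/
noncomputable instance : MeasureSpace ℍ[ℝ] :=
  ⟨Measure.map quatOfComplexPair.toContinuousLinearEquiv volume⟩

instance : (volume : Measure ℍ[ℝ]).IsAddHaarMeasure :=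
  have : (volume : Measure (ℂ × ℂ)).IsAddHaarMeasure :=
    inferInstanceAs ((volume : Measure ℂ).prod (volume : Measure ℂ)).IsAddHaarMeasure
  ContinuousLinearEquiv.isAddHaarMeasure_map quatOfComplexPair.toContinuousLinearEquiv volume

instance {m : Type*} [Fintype m] : (volume : Measure (m → ℍ[ℝ])).IsAddHaarMeasure :=
  inferInstanceAs (Measure.pi fun _ : m => (volume : Measure ℍ[ℝ])).IsAddHaarMeasure

instance {m n : Type*} [Fintype m] [Fintype n] :
    (volume : Measure (m → n → ℍ[ℝ])).IsAddHaarMeasure :=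
  Measure.pi.isAddHaarMeasure (fun _ : m => (volume : Measure (n → ℍ[ℝ])))

theorem measurePreserving_quatOfComplexPair :
    MeasurePreserving (fun p : ℂ × ℂ => quatOfComplexPair p) :=
  ⟨quatOfComplexPair.toContinuousLinearEquiv.continuous.measurable, rfl⟩

theorem lintegral_eq_det_mul_lintegral_comp {E : Type*} [NormedAddCommGroup E] [NormedSpace ℝ E]
    [MeasurableSpace E] [BorelSpace E] [FiniteDimensional ℝ E] (μ : Measure E)
    [μ.IsAddHaarMeasure] (T : E →ₗ[ℝ] E) (hT : LinearMap.det T ≠ 0) {f : E → ℝ≥0∞}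
    (hf : Measurable f) :
    ∫⁻ x, f x ∂μ = ENNReal.ofReal |LinearMap.det T| * ∫⁻ x, f (T x) ∂μ := by
  have hTm : Measurable T := (LinearMap.continuous_of_finiteDimensional T).measurable
  rw [← lintegral_map hf hTm, Measure.map_linearMap_addHaar_eq_smul_addHaar μ hT,
    lintegral_smul_measure, smul_eq_mul, ← mul_assoc, ← ENNReal.ofReal_mul (abs_nonneg _),
    ← abs_mul, mul_inv_cancel₀ hT]
  simp

variable {m n : Type*}

/-- Right multiplication by a quaternion matrix as a real-linear map. -/
noncomputable def quatMulRight [Fintype n] (H : Matrix n n ℍ[ℝ]) :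
    (m → n → ℍ[ℝ]) →ₗ[ℝ] (m → n → ℍ[ℝ]) where
  toFun B := (Matrix.of B : Matrix m n ℍ[ℝ]) * H
  map_add' A B := Matrix.add_mul (Matrix.of A) (Matrix.of B) H
  map_smul' r A := Matrix.smul_mul r (Matrix.of A) H

/-- Left multiplication by a quaternion matrix as a real-linear map. -/
noncomputable def quatMulLeft [Fintype m] (S : Matrix m m ℍ[ℝ]) :
    (m → n → ℍ[ℝ]) →ₗ[ℝ] (m → n → ℍ[ℝ]) where
  toFun B := S * (Matrix.of B : Matrix m n ℍ[ℝ])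
  map_add' A B := Matrix.mul_add S (Matrix.of A) (Matrix.of B)
  map_smul' r A := Matrix.mul_smul S r (Matrix.of A)

theorem lintegral_comp_mul_involution [Fintype m] [Fintype n] [DecidableEq n]
    {H : Matrix n n ℍ[ℝ]} (hH : H * H = 1) {f : (m → n → ℍ[ℝ]) → ℝ≥0∞} (hf : Measurable f) :
    ∫⁻ B, f (quatMulRight H B) = ∫⁻ B, f B := by
  have h : LinearMap.det (quatMulRight H : (m → n → ℍ[ℝ]) →ₗ[ℝ] _) *
      LinearMap.det (quatMulRight H : (m → n → ℍ[ℝ]) →ₗ[ℝ] _) = 1 := by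
    rw [← LinearMap.det_comp]
    convert LinearMap.det_id
    refine LinearMap.ext fun B => ?_
    change (Matrix.of B : Matrix m n ℍ[ℝ]) * H * H = B
    rw [Matrix.mul_assoc, hH, Matrix.mul_one]
    rfl
  have h1 : |LinearMap.det (quatMulRight H : (m → n → ℍ[ℝ]) →ₗ[ℝ] _)| = 1 := by
    rcases mul_self_eq_one_iff.1 h with h | h <;> simp [h]
  rw [lintegral_eq_det_mul_lintegral_comp volume (quatMulRight H) (by
    intro h0; simp [h0] at h) hf, h1]
  simp

/-- The first columns of the `2 × 2` blocks determine a quaternion matrix. -/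
noncomputable def quatColumns : (m → n → ℍ[ℝ]) ≃ₗ[ℝ] (n → m × Fin 2 → ℂ) where
  toFun A j i := quatRep (Matrix.of A) i (j, 0)
  invFun Y i j := ⟨(Y j (i, 0)).re, (Y j (i, 0)).im, -(Y j (i, 1)).re, (Y j (i, 1)).im⟩
  map_add' A B := by ext j i; exact congrFun (congrFun (quatRep_add (.of A) (.of B)) i) (j, 0)
  map_smul' r A := by ext j i; exact congrFun (congrFun (quatRep_smul r (.of A)) i) (j, 0)
  left_inv A := by ext i j <;> simp [quatRep]
  right_inv Y := by
    ext j ⟨i, a⟩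
    fin_cases a <;> apply Complex.ext <;> simp [quatRep] <;>
      first | rfl | exact neg_neg _

theorem abs_det_quatMulLeft [Fintype m] [DecidableEq m] [Fintype n] (S : Matrix m m ℍ[ℝ]) :
    |LinearMap.det (quatMulLeft S : (m → n → ℍ[ℝ]) →ₗ[ℝ] _)| =
      (quatDet S ^ 2) ^ Fintype.card n := by
  let T : (n → m × Fin 2 → ℂ) →ₗ[ℝ] (n → m × Fin 2 → ℂ) :=
    LinearMap.pi fun j =>
      ((Matrix.toLin' (quatRep S)).restrictScalars ℝ).comp (LinearMap.proj j)
  have hT : quatColumns.toLinearMap ∘ₗ ((quatMulLeft S : (m → n → ℍ[ℝ]) →ₗ[ℝ] _) ∘ₗ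
      quatColumns.symm.toLinearMap) = T := by
    refine LinearMap.ext fun Y => ?_
    obtain ⟨A, rfl⟩ := quatColumns.surjective Y
    ext1 j
    ext1 i
    simp only [LinearMap.comp_apply, LinearEquiv.coe_coe, LinearEquiv.symm_apply_apply]
    exact congrFun (congrFun (quatRep_mul S (.of A)) i) (j, 0)
  rw [← LinearMap.det_conj _ quatColumns, hT, LinearMap.det_pi, LinearMap.det_restrictScalars,
    Algebra.norm_complex_apply, LinearMap.det_toLin', Finset.prod_const, Complex.normSq_eq_norm_sq]
  simp [quatDet]

theorem lintegral_eq_quatDet_mul_lintegral_mul [Fintype m] [DecidableEq m] [Fintype n]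
    {S : Matrix m m ℍ[ℝ]} (hS : quatDet S ≠ 0) {f : (m → n → ℍ[ℝ]) → ℝ≥0∞} (hf : Measurable f) :
    ∫⁻ A, f A = ENNReal.ofReal ((quatDet S ^ 2) ^ Fintype.card n) *
      ∫⁻ A, f (quatMulLeft S A) := by
  have h := abs_det_quatMulLeft (n := n) S
  rw [← h]
  refine lintegral_eq_det_mul_lintegral_comp volume _ (fun h0 => ?_) hf
  rw [h0, abs_zero] at h
  exact pow_ne_zero _ (pow_ne_zero 2 hS) h.symm

theorem lintegral_eq_pow_mul_lintegral_smul [Fintype m] {s : ℝ} (hs : 0 < s)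
    {f : (m → Unit → ℍ[ℝ]) → ℝ≥0∞} (hf : Measurable f) :
    ∫⁻ b, f b = ENNReal.ofReal (s ^ (4 * Fintype.card m)) * ∫⁻ b, f (s • b) := by
  have h : LinearMap.det (s • (LinearMap.id : (m → Unit → ℍ[ℝ]) →ₗ[ℝ] _)) =
      s ^ (4 * Fintype.card m) := by
    rw [LinearMap.det_smul, LinearMap.det_id, mul_one, Module.finrank_pi_fintype]
    simp [Quaternion.finrank_eq_four, Module.finrank_pi_fintype, mul_comm]
  have hp : 0 < s ^ (4 * Fintype.card m) := pow_pos hs _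
  rw [lintegral_eq_det_mul_lintegral_comp volume (s • LinearMap.id) (by rw [h]; exact hp.ne') hf,
    h, abs_of_pos hp]
  rfl

end

section

theorem integrableOn_and_integral_Ioi_pow_div (u c : ℕ) :
    IntegrableOn (fun s : ℝ => s ^ u / (1 + s) ^ (u + c + 2)) (Set.Ioi 0) ∧
      ∫ s in Set.Ioi (0 : ℝ), s ^ u / (1 + s) ^ (u + c + 2) =
        (u.factorial * c.factorial : ℝ) / (u + c + 1).factorial := by
  induction c with
  | zero =>
    have hd : ∀ s ∈ Set.Ici (0 : ℝ), HasDerivAt (fun s : ℝ => (s / (1 + s)) ^ (u + 1) / (u + 1))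
        (s ^ u / (1 + s) ^ (u + 0 + 2)) s := by
      intro s hs
      have hs0 : (1 + s) ≠ 0 := by have : (0 : ℝ) ≤ s := hs; positivity
      have h1 : HasDerivAt (fun s : ℝ => s / (1 + s)) ((1 * (1 + s) - s * 1) / (1 + s) ^ 2) s :=
        (hasDerivAt_id' s).div ((hasDerivAt_id' s).const_add 1) hs0
      refine ((h1.pow (u + 1)).div_const ((u : ℝ) + 1)).congr_deriv ?_
      have : (u : ℝ) + 1 ≠ 0 := by positivity
      rw [Nat.add_sub_cancel, div_pow]
      push_cast
      field_simp
      ring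
    have hl : Filter.Tendsto (fun s : ℝ => (s / (1 + s)) ^ (u + 1) / (u + 1)) Filter.atTop
        (nhds (1 ^ (u + 1) / (u + 1))) := by
      refine Filter.Tendsto.div_const (Filter.Tendsto.pow ?_ _) _
      have h2 : Filter.Tendsto (fun s : ℝ => 1 - (1 + s)⁻¹) Filter.atTop (nhds (1 - 0)) :=
        tendsto_const_nhds.sub (tendsto_inv_atTop_zero.comp
          (Filter.tendsto_atTop_add_const_left _ 1 Filter.tendsto_id))
      rw [sub_zero] at h2
      refine h2.congr' ?_
      filter_upwards [Filter.eventually_ge_atTop 0] with s hs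
      have hs0 : (1 + s) ≠ 0 := by positivity
      field_simp
      ring
    have hp : ∀ s ∈ Set.Ioi (0 : ℝ), 0 ≤ s ^ u / (1 + s) ^ (u + 0 + 2) := fun s hs => by
      have : (0 : ℝ) < s := hs
      positivity
    refine ⟨integrableOn_Ioi_deriv_of_nonneg' hd hp hl, ?_⟩
    rw [integral_Ioi_of_hasDerivAt_of_nonneg' hd hp hl]
    simp [Nat.factorial_succ]
    have := Nat.factorial_ne_zero u
    field_simp
  | succ c ih =>
    obtain ⟨hi, hv⟩ := ih
    have hint : IntegrableOn (fun s : ℝ => s ^ u / (1 + s) ^ (u + (c + 1) + 2)) (Set.Ioi 0) := by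
      refine hi.mono' (Measurable.aestronglyMeasurable (by fun_prop)) ?_
      filter_upwards [ae_restrict_mem measurableSet_Ioi] with s hs
      have hs0 : (0 : ℝ) < s := hs
      rw [Real.norm_of_nonneg (by positivity)]
      refine div_le_div_of_nonneg_left (by positivity) (by positivity) ?_
      exact pow_le_pow_right₀ (by linarith) (by omega)
    refine ⟨hint, ?_⟩
    have hd : ∀ s ∈ Set.Ici (0 : ℝ), HasDerivAt (fun s : ℝ => s ^ (u + 1) / (1 + s) ^ (u + c + 2))
        ((u + c + 2 : ℝ) * (s ^ u / (1 + s) ^ (u + (c + 1) + 2)) -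
          (c + 1) * (s ^ u / (1 + s) ^ (u + c + 2))) s := by
      intro s hs
      have hs0 : (1 + s) ≠ 0 := by have : (0 : ℝ) ≤ s := hs; positivity
      refine ((hasDerivAt_pow (u + 1) s).div
        (((hasDerivAt_id' s).const_add 1).pow (u + c + 2)) (pow_ne_zero _ hs0)).congr_deriv ?_
      rw [Pi.pow_apply, Nat.add_sub_cancel, show u + c + 2 - 1 = u + c + 1 from rfl]
      push_cast
      field_simp
      ring
    have hl : Filter.Tendsto (fun s : ℝ => s ^ (u + 1) / (1 + s) ^ (u + c + 2)) Filter.atTop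
        (nhds 0) := by
      refine squeeze_zero' (g := fun s : ℝ => (1 + s)⁻¹) ?_ ?_
        (tendsto_inv_atTop_zero.comp (Filter.tendsto_atTop_add_const_left _ 1 Filter.tendsto_id))
      · filter_upwards [Filter.eventually_ge_atTop 0] with s hs
        positivity
      · filter_upwards [Filter.eventually_ge_atTop 0] with s hs
        have hs0 : 1 + s ≠ 0 := by positivity
        rw [div_le_iff₀ (by positivity), show u + c + 2 = (u + c + 1) + 1 from rfl,
          pow_succ' (1 + s), inv_mul_cancel_left₀ hs0]
        calc s ^ (u + 1) ≤ (1 + s) ^ (u + 1) := pow_le_pow_left₀ hs (by linarith) _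
          _ ≤ (1 + s) ^ (u + c + 1) := pow_le_pow_right₀ (by linarith) (by omega)
    have h := integral_Ioi_of_hasDerivAt_of_tendsto' hd
      ((hint.const_mul _).sub (hi.const_mul _)) hl
    rw [integral_sub (hint.const_mul _) (hi.const_mul _), integral_const_mul, integral_const_mul,
      hv] at h
    have e1 : ((u + (c + 1) + 1).factorial : ℝ) = (u + c + 2) * (u + c + 1).factorial := by
      rw [show u + (c + 1) + 1 = (u + c + 1) + 1 by ring, Nat.factorial_succ]
      push_cast
      ring
    have e2 : ((c + 1).factorial : ℝ) = (c + 1) * c.factorial := by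
      rw [Nat.factorial_succ]; push_cast; ring
    have h3 : ((u + c + 1).factorial : ℝ) ≠ 0 := by positivity
    have h4 : (u + c + 2 : ℝ) ≠ 0 := by positivity
    rw [e1, e2, eq_div_iff (mul_ne_zero h4 h3)]
    field_simp at h
    simp at h
    linear_combination h

theorem measurable_vecNormSq {n : Type*} [Fintype n] : Measurable (vecNormSq : (n → ℍ[ℝ]) → ℝ) := by
  have : Continuous (vecNormSq : (n → ℍ[ℝ]) → ℝ) :=
    continuous_finsetSum _ fun i _ => Quaternion.continuous_normSq.comp (continuous_apply i)
  exact this.measurable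

/-- Coordinates of a quaternion vector by pairs of complex vectors. -/
noncomputable def vecOfComplex {n : Type*} (x : n ⊕ n → ℂ) : n → ℍ[ℝ] :=
  fun i => quatOfComplexPair (x (.inl i), x (.inr i))

theorem measurePreserving_vecOfComplex {n : Type*} [Fintype n] :
    MeasurePreserving (vecOfComplex : (n ⊕ n → ℂ) → n → ℍ[ℝ]) :=
  (volume_preserving_pi fun _ : n => measurePreserving_quatOfComplexPair).comp
    (((volume_measurePreserving_arrowProdEquivProdArrow ℂ ℂ n).symm).comp
      (volume_measurePreserving_sumPiEquivProdPi fun _ : n ⊕ n => ℂ))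

theorem vecNormSq_vecOfComplex {n : Type*} [Fintype n] (x : n ⊕ n → ℂ) :
    vecNormSq (vecOfComplex x) = ∑ i, ‖x i‖ ^ (2 : ℝ) := by
  simp only [vecNormSq, vecOfComplex, Fintype.sum_sum_type, ← Finset.sum_add_distrib]
  refine Finset.sum_congr rfl fun i _ => ?_
  simp only [Real.rpow_two, ← Complex.normSq_eq_norm_sq, Complex.normSq_apply,
    Quaternion.normSq_def']
  change (x (.inl i)).re ^ 2 + (x (.inl i)).im ^ 2 + (x (.inr i)).re ^ 2 +
    (x (.inr i)).im ^ 2 = _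
  ring

theorem volume_vecNormSq_lt {n : Type*} [Fintype n] [Nonempty n] (s : ℝ) :
    volume {v : n → ℍ[ℝ] | vecNormSq v < s} = ENNReal.ofReal
      (Real.pi ^ (2 * Fintype.card n) / (2 * Fintype.card n).factorial *
        (max s 0) ^ (2 * Fintype.card n)) := by
  rw [← measurePreserving_vecOfComplex.measure_preimage
    (measurableSet_lt measurable_vecNormSq measurable_const).nullMeasurableSet]
  have hd : Fintype.card (n ⊕ n) = 2 * Fintype.card n := by
    rw [Fintype.card_sum]; ring
  rcases le_or_gt s 0 with hs | hs
  · have : (vecOfComplex ⁻¹' {v : n → ℍ[ℝ] | vecNormSq v < s}) = ∅ := by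
      ext x
      simp [hs.trans (vecNormSq_nonneg _)]
    rw [this, max_eq_right hs]
    simp
  · have h := Complex.volume_sum_rpow_lt (ι := n ⊕ n) one_le_two (Real.sqrt s)
    have e : {x : n ⊕ n → ℂ | (∑ i, ‖x i‖ ^ (2 : ℝ)) ^ (1 / 2 : ℝ) < Real.sqrt s} =
        vecOfComplex ⁻¹' {v : n → ℍ[ℝ] | vecNormSq v < s} := by
      ext x
      simp only [Set.mem_ofPred_eq, Set.mem_preimage, vecNormSq_vecOfComplex]
      rw [← Real.sqrt_eq_rpow, Real.sqrt_lt_sqrt_iff (by positivity)]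
    rw [e, hd] at h
    rw [h, ← ENNReal.ofReal_pow (Real.sqrt_nonneg _), ← ENNReal.ofReal_mul (by positivity),
      pow_mul, Real.sq_sqrt hs.le, max_eq_left hs.le]
    congr 1
    have g : Real.Gamma (2 * ((2 * Fintype.card n : ℕ) : ℝ) / 2 + 1) =
        ((2 * Fintype.card n).factorial : ℝ) := by
      rw [← Real.Gamma_nat_eq_factorial]
      congr 1
      ring
    rw [g]
    norm_num [Real.Gamma_two]
    ring

/-- Radial integration over quaternion vectors. -/
theorem lintegral_comp_vecNormSq {n : Type*} [Fintype n] [Nonempty n] {F : ℝ → ℝ≥0∞}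
    (hF : Measurable F) :
    ∫⁻ v : n → ℍ[ℝ], F (vecNormSq v) = ∫⁻ s in Set.Ioi (0 : ℝ), ENNReal.ofReal
      (Real.pi ^ (2 * Fintype.card n) / (2 * Fintype.card n - 1).factorial *
        s ^ (2 * Fintype.card n - 1)) * F s := by
  obtain ⟨D, hD⟩ : ∃ D, 2 * Fintype.card n = D + 1 :=
    ⟨2 * Fintype.card n - 1, by have := Fintype.card_pos (α := n); omega⟩
  set g : ℝ → ℝ≥0∞ := fun s => ENNReal.ofReal (Real.pi ^ (D + 1) / D.factorial * s ^ D) with hg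
  have hgm : Measurable g := by fun_prop
  have key : Measure.map vecNormSq (volume : Measure (n → ℍ[ℝ])) =
      (volume.restrict (Set.Ioi (0 : ℝ))).withDensity g := by
    have h1 : ∀ s : ℝ, Measure.map vecNormSq (volume : Measure (n → ℍ[ℝ])) (Set.Iio s) =
        ENNReal.ofReal (Real.pi ^ (D + 1) / (D + 1).factorial * (max s 0) ^ (D + 1)) := by
      intro s
      rw [Measure.map_apply measurable_vecNormSq measurableSet_Iio, ← hD, ← volume_vecNormSq_lt]
      rfl
    have h2 : ∀ s : ℝ, ((volume.restrict (Set.Ioi (0 : ℝ))).withDensity g) (Set.Iio s) =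
        ENNReal.ofReal (Real.pi ^ (D + 1) / (D + 1).factorial * (max s 0) ^ (D + 1)) := by
      intro s
      rw [withDensity_apply _ measurableSet_Iio, Measure.restrict_restrict measurableSet_Iio,
        Set.inter_comm, Set.Ioi_inter_Iio, Measure.restrict_congr_set Ioo_ae_eq_Ioc]
      rcases le_or_gt s 0 with hs | hs
      · simp [hs]
      rw [← ofReal_integral_eq_lintegral_ofReal, ← intervalIntegral.integral_of_le hs.le,
        intervalIntegral.integral_const_mul, integral_pow, max_eq_left hs.le]
      · congr 1
        rw [Nat.factorial_succ]
        have := Nat.factorial_ne_zero D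
        push_cast
        field_simp
        simp
      · exact (Continuous.integrableOn_Icc (by fun_prop)).mono_set Set.Ioc_subset_Icc_self
      · filter_upwards [ae_restrict_mem measurableSet_Ioc] with x hx
        have : 0 < x := hx.1
        simp only [Pi.zero_apply]
        positivity
    have h3 : ∀ (μ : Measure ℝ) (a b : ℝ), a < b → μ (Set.Iio a) ≠ ∞ →
        μ (Set.Ico a b) = μ (Set.Iio b) - μ (Set.Iio a) := by
      intro μ a b hab h
      rw [← measure_sdiff (Set.Iio_subset_Iio hab.le) measurableSet_Iio.nullMeasurableSet h]
      congr 1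
      ext x
      simp
    refine Measure.ext_of_Ico' _ _ (fun a b hab => ?_) fun a b hab => ?_
    · refine ne_top_of_le_ne_top ?_ (measure_mono Set.Ico_subset_Iio_self)
      rw [h1]
      exact ENNReal.ofReal_ne_top
    · rw [h3 _ a b hab (by rw [h1]; exact ENNReal.ofReal_ne_top),
        h3 _ a b hab (by rw [h2]; exact ENNReal.ofReal_ne_top)]
      simp only [h1, h2]
  rw [← lintegral_map hF measurable_vecNormSq, key, lintegral_withDensity_eq_lintegral_mul _ hgm hF,
    hD]
  rfl

theorem lintegral_vecNormSq_pow_div {n : Type*} [Fintype n] [Nonempty n] (a c : ℕ) :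
    ∫⁻ v : n → ℍ[ℝ], ENNReal.ofReal
      (vecNormSq v ^ a / (1 + vecNormSq v) ^ (2 * Fintype.card n + a + c + 1)) =
      ENNReal.ofReal (Real.pi ^ (2 * Fintype.card n) / (2 * Fintype.card n - 1).factorial *
        ((2 * Fintype.card n - 1 + a).factorial * c.factorial /
          (2 * Fintype.card n + a + c).factorial)) := by
  obtain ⟨D, hD⟩ : ∃ D, 2 * Fintype.card n = D + 1 :=
    ⟨2 * Fintype.card n - 1, by have := Fintype.card_pos (α := n); omega⟩
  rw [lintegral_comp_vecNormSq (n := n)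
    (F := fun s => ENNReal.ofReal (s ^ a / (1 + s) ^ (2 * Fintype.card n + a + c + 1)))
    (by fun_prop), hD, Nat.add_sub_cancel]
  have h := integrableOn_and_integral_Ioi_pow_div (D + a) c
  rw [show D + 1 + a + c = D + a + c + 1 by ring, ← h.2, ← integral_const_mul,
    ofReal_integral_eq_lintegral_ofReal (h.1.const_mul _)]
  · refine setLIntegral_congr_fun measurableSet_Ioi fun s hs => ?_
    have hs0 : (0 : ℝ) < s := hs
    rw [← ENNReal.ofReal_mul (by positivity)]
    congr 1
    ring
  · filter_upwards [ae_restrict_mem measurableSet_Ioi] with s hs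
    have hs0 : (0 : ℝ) < s := hs
    simp only [Pi.zero_apply]
    positivity

theorem lintegral_one_div_vecNormSq {n : Type*} [Fintype n] (c : ℕ) :
    ∫⁻ v : n → ℍ[ℝ], ENNReal.ofReal (1 / (1 + vecNormSq v) ^ (2 * Fintype.card n + c + 1)) =
      ENNReal.ofReal (Real.pi ^ (2 * Fintype.card n) * c.factorial /
        (2 * Fintype.card n + c).factorial) := by
  rcases isEmpty_or_nonempty n with hn | hn
  · have : (volume : Measure (n → ℍ[ℝ])) Set.univ = 1 := by
      rw [volume_pi, Measure.pi_univ]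
      simp
    have h0 : (c.factorial : ℝ) ≠ 0 := by positivity
    simp [vecNormSq, this, div_self h0]
  · convert lintegral_vecNormSq_pow_div (n := n) 0 c using 3
    · simp
    · have : ((2 * Fintype.card n - 1).factorial : ℝ) ≠ 0 := by positivity
      simp only [add_zero]
      field_simp

end

section

variable {ι κ : Type*} [Fintype ι] [DecidableEq ι] [Fintype κ] [DecidableEq κ]

/-- The unnormalized induced spherical density. -/
noncomputable def quatWeight (L m : ℕ) (G : Matrix ι ι ℍ[ℝ]) : ℝ :=
  quatDet G ^ (2 * L) / quatDet (1 + G * Gᴴ) ^ m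

variable (ι) in
/-- The total mass of the induced spherical density. -/
noncomputable def quatMass (L m : ℕ) : ℝ≥0∞ :=
  ∫⁻ G : ι → ι → ℍ[ℝ], ENNReal.ofReal (quatWeight L m (Matrix.of G))

theorem continuous_quatDet : Continuous (quatDet : Matrix ι ι ℍ[ℝ] → ℝ) := by
  have h : ∀ f g : Matrix ι ι ℍ[ℝ] → ℝ, Continuous f → Continuous g →
      Continuous fun X => (⟨f X, g X⟩ : ℂ) := fun f g hf hg =>
    Complex.equivRealProdCLM.symm.continuous.comp (hf.prodMk hg)
  have : Continuous (quatRep : Matrix ι ι ℍ[ℝ] → Matrix (ι × Fin 2) (ι × Fin 2) ℂ) := by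
    refine continuous_matrix ?_
    rintro ⟨i, a⟩ ⟨j, b⟩
    have hX : Continuous fun X : Matrix ι ι ℍ[ℝ] => X i j := continuous_id.matrix_elem i j
    have h1 := h _ _ (Quaternion.continuous_re.comp hX) (Quaternion.continuous_imI.comp hX)
    have h2 := h _ _ (Quaternion.continuous_imJ.comp hX) (Quaternion.continuous_imK.comp hX)
    fin_cases a <;> fin_cases b
    · exact h1
    · exact h2
    · exact (Complex.continuous_conj.comp h2).neg
    · exact Complex.continuous_conj.comp h1
  exact this.matrix_det.norm

theorem quatWeight_nonneg (L m : ℕ) (G : Matrix ι ι ℍ[ℝ]) : 0 ≤ quatWeight L m G :=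
  div_nonneg (pow_nonneg (quatDet_nonneg _) _) (pow_nonneg (quatDet_nonneg _) _)

theorem continuous_quatWeight (L m : ℕ) :
    Continuous (quatWeight L m : Matrix ι ι ℍ[ℝ] → ℝ) := by
  refine (continuous_quatDet.pow _).div ((continuous_quatDet.comp ?_).pow _) fun G =>
    pow_ne_zero _ (det_one_add_quatRep_mul_conjTranspose G).2.ne'
  exact continuous_const.add (continuous_id.matrix_mul continuous_id.matrix_conjTranspose)

theorem measurable_ofReal_quatWeight (L m : ℕ) :
    Measurable fun G : ι → ι → ℍ[ℝ] => ENNReal.ofReal (quatWeight L m (Matrix.of G)) := by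
  have : Continuous fun G : ι → ι → ℍ[ℝ] => quatWeight L m (Matrix.of G) :=
    continuous_quatWeight L m
  exact this.measurable.ennreal_ofReal

theorem quatWeight_submatrix (L m : ℕ) (e : κ ≃ ι) (G : Matrix ι ι ℍ[ℝ]) :
    quatWeight L m (G.submatrix e e) = quatWeight L m G := by
  have : 1 + G.submatrix e e * (G.submatrix e e)ᴴ = (1 + G * Gᴴ).submatrix e e := by
    rw [Matrix.conjTranspose_submatrix, Matrix.submatrix_mul_equiv, ← Matrix.submatrix_one_equiv e]
    rfl
  rw [quatWeight, this, quatDet_submatrix, quatDet_submatrix, quatWeight]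

theorem quatMass_congr (e : ι ≃ κ) (L m : ℕ) : quatMass ι L m = quatMass κ L m := by
  have h1 := volume_measurePreserving_piCongrLeft (fun _ : κ => κ → ℍ[ℝ]) e
  have h2 := volume_preserving_pi fun _ : ι =>
    volume_measurePreserving_piCongrLeft (fun _ : κ => ℍ[ℝ]) e
  have h := h1.comp h2
  rw [quatMass, quatMass, ← h.lintegral_comp]
  · refine lintegral_congr fun G => ?_
    rw [← quatWeight_submatrix L m e]
    congr 2
    ext1 i j
    simp [MeasurableEquiv.coe_piCongrLeft]
  · exact measurable_ofReal_quatWeight L m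

theorem lintegral_fromRows {m₁ m₂ n : Type*} [Fintype m₁] [Fintype m₂] [Fintype n]
    {g : Matrix (m₁ ⊕ m₂) n ℍ[ℝ] → ℝ≥0∞} (hg : Measurable fun p :
      (m₁ → n → ℍ[ℝ]) × (m₂ → n → ℍ[ℝ]) => g (fromRows (Matrix.of p.1) (Matrix.of p.2))) :
    ∫⁻ G : m₁ ⊕ m₂ → n → ℍ[ℝ], g (Matrix.of G) =
      ∫⁻ v : m₁ → n → ℍ[ℝ], ∫⁻ B : m₂ → n → ℍ[ℝ], g (fromRows (Matrix.of v) (Matrix.of B)) := by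
  have h := volume_measurePreserving_sumPiEquivProdPi fun _ : m₁ ⊕ m₂ => n → ℍ[ℝ]
  rw [← lintegral_prod _ hg.aemeasurable, ← Measure.volume_eq_prod, ← h.lintegral_comp hg]
  refine lintegral_congr fun G => congrArg g ?_
  ext1 (i | i) j <;> rfl

theorem lintegral_fromCols {m n₁ n₂ : Type*} [Fintype m] [Fintype n₁] [Fintype n₂]
    {g : Matrix m (n₁ ⊕ n₂) ℍ[ℝ] → ℝ≥0∞} (hg : Measurable fun p :
      (m → n₁ → ℍ[ℝ]) × (m → n₂ → ℍ[ℝ]) => g (fromCols (Matrix.of p.1) (Matrix.of p.2))) :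
    ∫⁻ G : m → n₁ ⊕ n₂ → ℍ[ℝ], g (Matrix.of G) =
      ∫⁻ b : m → n₁ → ℍ[ℝ], ∫⁻ A : m → n₂ → ℍ[ℝ], g (fromCols (Matrix.of b) (Matrix.of A)) := by
  have : SigmaFinite (volume : Measure ((n₁ → ℍ[ℝ]) × (n₂ → ℍ[ℝ]))) :=
    inferInstanceAs (SigmaFinite (Measure.prod volume volume))
  have h := (volume_measurePreserving_arrowProdEquivProdArrow (n₁ → ℍ[ℝ]) (n₂ → ℍ[ℝ]) m).comp
    (volume_preserving_pi (β' := fun _ => (n₁ → ℍ[ℝ]) × (n₂ → ℍ[ℝ])) fun _ : m =>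
      volume_measurePreserving_sumPiEquivProdPi fun _ : n₁ ⊕ n₂ => ℍ[ℝ])
  rw [← lintegral_prod _ hg.aemeasurable, ← Measure.volume_eq_prod, ← h.lintegral_comp hg]
  refine lintegral_congr fun G => congrArg g ?_
  ext1 i (j | j) <;> rfl

theorem quatWeight_mul_involution (L m : ℕ) (G H : Matrix ι ι ℍ[ℝ]) (h1 : H * H = 1)
    (h2 : Hᴴ = H) : quatWeight L m (G * H) = quatWeight L m G := by
  have hd : quatDet H = 1 := by
    have h := congrArg quatDet h1
    rw [quatDet_mul, quatDet_one] at h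
    nlinarith [quatDet_nonneg H]
  rw [quatWeight, quatWeight, quatDet_mul, hd, mul_one, Matrix.conjTranspose_mul, h2,
    Matrix.mul_assoc, ← Matrix.mul_assoc H, h1, Matrix.one_mul]

theorem quatWeight_fromBlocks (L m : ℕ) (Q : Matrix Unit Unit ℍ[ℝ]) (b : Matrix κ Unit ℍ[ℝ])
    (A : Matrix κ κ ℍ[ℝ]) {r : ℝ} (hr : Quaternion.normSq (Q () ()) = r) :
    quatWeight L m (fromBlocks Q 0 b A) =
      r ^ (2 * L) / (1 + r) ^ (2 * m) * (quatDet A ^ (2 * L) /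
        quatDet (1 + (1 + r)⁻¹ • (b * bᴴ) + A * Aᴴ) ^ m) := by
  have hr0 : 0 ≤ r := hr ▸ Quaternion.normSq_nonneg
  have hr1 : 1 + r ≠ 0 := by positivity
  have hv : vecNormSq (Q ()) = r := by simp [vecNormSq, hr]
  have hv' : vecNormSq (fun i => Q i ()) = r := by simp [vecNormSq, hr]
  have hG : 1 + fromBlocks Q 0 b A * (fromBlocks Q 0 b A)ᴴ =
      fromBlocks ((1 + r) • 1) (Q * bᴴ) (b * Qᴴ) (1 + (b * bᴴ + A * Aᴴ)) := by
    rw [← Matrix.fromBlocks_one, Matrix.fromBlocks_conjTranspose, Matrix.fromBlocks_multiply,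
      Matrix.fromBlocks_add, row_mul_conjTranspose, hv, add_smul, one_smul]
    simp
  have hs : 1 + (b * bᴴ + A * Aᴴ) - (1 + r)⁻¹ • (b * Qᴴ * (Q * bᴴ)) =
      1 + (1 + r)⁻¹ • (b * bᴴ) + A * Aᴴ := by
    rw [Matrix.mul_assoc, ← Matrix.mul_assoc Qᴴ, conjTranspose_mul_col, hv', Matrix.smul_mul,
      Matrix.one_mul, Matrix.mul_smul, smul_smul]
    have : (1 + r)⁻¹ = 1 - (1 + r)⁻¹ * r := by field_simp; ring
    nth_rewrite 2 [this]
    rw [sub_smul, one_smul]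
    abel
  rw [quatWeight, hG, quatDet_fromBlocks_smul_one hr1, hs, quatDet_fromBlocks_zero₁₂, quatDet_unit,
    hr, Fintype.card_unit, pow_one, mul_pow, mul_pow, ← pow_mul]
  ring

theorem exists_sqrt_one_add_col (b : Matrix κ Unit ℍ[ℝ]) :
    ∃ S : Matrix κ κ ℍ[ℝ], Sᴴ = S ∧ S * S = 1 + b * bᴴ ∧
      quatDet S = 1 + vecNormSq fun i => b i () := by
  set β := vecNormSq fun i => b i () with hβ
  have hβ0 : 0 ≤ β := vecNormSq_nonneg _
  set w := Real.sqrt (1 + β) with hw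
  have hw0 : 0 ≤ w := Real.sqrt_nonneg _
  have hw2 : w ^ 2 = 1 + β := Real.sq_sqrt (by positivity)
  have hSS : (1 + (1 + w)⁻¹ • (b * bᴴ)) * (1 + (1 + w)⁻¹ • (b * bᴴ)) = 1 + b * bᴴ := by
    have hbb : b * bᴴ * (b * bᴴ) = β • (b * bᴴ) := by
      rw [Matrix.mul_assoc, ← Matrix.mul_assoc bᴴ, conjTranspose_mul_col, Matrix.smul_mul,
        Matrix.one_mul, Matrix.mul_smul]
    rw [Matrix.add_mul, Matrix.mul_add, Matrix.mul_add, Matrix.one_mul, Matrix.mul_one,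
      Matrix.one_mul, Matrix.smul_mul, Matrix.mul_smul, hbb, smul_smul, smul_smul, add_assoc,
      ← add_smul, ← add_smul]
    have : (1 + w)⁻¹ + ((1 + w)⁻¹ + (1 + w)⁻¹ * (1 + w)⁻¹ * β) = 1 := by
      have : β = w ^ 2 - 1 := by linarith only [hw2]
      rw [this]
      field_simp
      ring
    rw [this, one_smul]
  refine ⟨1 + (1 + w)⁻¹ • (b * bᴴ), ?_, hSS, ?_⟩
  · rw [Matrix.conjTranspose_add, conjTranspose_real_smul, Matrix.conjTranspose_mul,
      Matrix.conjTranspose_conjTranspose, Matrix.conjTranspose_one]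
  · have h := congrArg quatDet hSS
    rw [quatDet_mul, quatDet_one_add_col, ← hβ, ← sq] at h
    exact (pow_left_inj₀ (quatDet_nonneg _) (by positivity) two_ne_zero).1 h

theorem lintegral_quatDet_ratio (L m p : ℕ) (hm : 2 * m = 2 * Fintype.card κ + 2 * L + p)
    (b : Matrix κ Unit ℍ[ℝ]) :
    ∫⁻ A : κ → κ → ℍ[ℝ], ENNReal.ofReal (quatDet (Matrix.of A) ^ (2 * L) /
        quatDet (1 + b * bᴴ + Matrix.of A * (Matrix.of A)ᴴ) ^ m) =
      ENNReal.ofReal (1 / (1 + vecNormSq fun i => b i ()) ^ p) * quatMass κ L m := by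
  obtain ⟨S, hS, hSS, hd⟩ := exists_sqrt_one_add_col b
  have hβ0 : 0 ≤ vecNormSq fun i => b i () := vecNormSq_nonneg _
  set β := vecNormSq fun i => b i ()
  have hβ1 : 0 < 1 + β := by positivity
  rw [lintegral_eq_quatDet_mul_lintegral_mul (S := S) (by rw [hd]; positivity)]
  · have : ∀ A : κ → κ → ℍ[ℝ], quatDet (Matrix.of (quatMulLeft S A)) ^ (2 * L) /
        quatDet (1 + b * bᴴ + Matrix.of (quatMulLeft S A) * (Matrix.of (quatMulLeft S A))ᴴ) ^ m =
        (1 + β) ^ (2 * L) / (1 + β) ^ (2 * m) * quatWeight L m (Matrix.of A) := by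
      intro A
      have e1 : Matrix.of (quatMulLeft S A) = S * Matrix.of A := rfl
      have e2 : 1 + b * bᴴ + S * Matrix.of A * (S * Matrix.of A)ᴴ =
          S * (1 + Matrix.of A * (Matrix.of A)ᴴ) * S := by
        rw [← hSS, Matrix.conjTranspose_mul, hS, Matrix.mul_add, Matrix.add_mul, Matrix.mul_one]
        simp only [Matrix.mul_assoc]
      rw [e1, e2, quatDet_mul, quatDet_mul, quatDet_mul, hd, quatWeight, mul_pow, mul_pow, mul_pow,
        pow_mul _ 2 m]
      simp only [div_eq_mul_inv, mul_inv, sq, mul_pow]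
      ring
    simp_rw [this]
    simp_rw [ENNReal.ofReal_mul (show 0 ≤ (1 + β) ^ (2 * L) / (1 + β) ^ (2 * m) by positivity)]
    rw [lintegral_const_mul _ (measurable_ofReal_quatWeight L m), ← mul_assoc, ← ENNReal.ofReal_mul (by positivity),
      hd, quatMass]
    congr 2
    rw [hm, ← pow_mul]
    field_simp
    ring
  · have hc : Continuous fun A : κ → κ → ℍ[ℝ] =>
        quatDet (1 + b * bᴴ + Matrix.of A * (Matrix.of A)ᴴ) :=
      continuous_quatDet.comp (continuous_const.add
        (Continuous.matrix_mul continuous_id continuous_id.matrix_conjTranspose))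
    have hc' : Continuous fun A : κ → κ → ℍ[ℝ] => quatDet (Matrix.of A) :=
      continuous_quatDet.comp continuous_id
    exact ((hc'.measurable.pow_const _).div (hc.measurable.pow_const _)).ennreal_ofReal

theorem quatMass_unit_sum (L m p : ℕ) (hm : 2 * m = 2 * Fintype.card κ + 2 * L + p) :
    quatMass (Unit ⊕ κ) L m =
      (∫⁻ v : Unit ⊕ κ → ℍ[ℝ], ENNReal.ofReal
        (vecNormSq v ^ (2 * L) / (1 + vecNormSq v) ^ (2 * L + p))) *
      ((∫⁻ b : κ → ℍ[ℝ], ENNReal.ofReal (1 / (1 + vecNormSq b) ^ p)) * quatMass κ L m) := by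
  have hW := continuous_quatWeight (ι := Unit ⊕ κ) L m
  have hrows : Continuous fun p : (Unit → Unit ⊕ κ → ℍ[ℝ]) × (κ → Unit ⊕ κ → ℍ[ℝ]) =>
      fromRows (Matrix.of p.1) (Matrix.of p.2) := by
    refine continuous_matrix ?_
    rintro (i | i) j
    · exact (continuous_apply_apply i j).comp continuous_fst
    · exact (continuous_apply_apply i j).comp continuous_snd
  have hblocks : ∀ Q : Matrix Unit Unit ℍ[ℝ], Continuous fun p : (κ → Unit → ℍ[ℝ]) × (κ → κ → ℍ[ℝ]) =>
      fromBlocks Q 0 (Matrix.of p.1) (Matrix.of p.2) := by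
    intro Q
    exact continuous_const.matrix_fromBlocks continuous_const continuous_fst continuous_snd
  have hcol : ∫⁻ b : κ → Unit → ℍ[ℝ], ENNReal.ofReal (1 / (1 + vecNormSq fun i => b i ()) ^ p) =
      ∫⁻ b : κ → ℍ[ℝ], ENNReal.ofReal (1 / (1 + vecNormSq b) ^ p) := by
    have h := volume_preserving_pi fun _ : κ => volume_preserving_funUnique Unit ℍ[ℝ]
    rw [← h.lintegral_comp]
    · rfl
    · exact (measurable_const.div
        ((measurable_const.add measurable_vecNormSq).pow_const _)).ennreal_ofReal
  have hinner : ∀ v : Unit → Unit ⊕ κ → ℍ[ℝ],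
      ∫⁻ B : κ → Unit ⊕ κ → ℍ[ℝ], ENNReal.ofReal
        (quatWeight L m (fromRows (Matrix.of v) (Matrix.of B))) =
      ENNReal.ofReal (vecNormSq (v ()) ^ (2 * L) / (1 + vecNormSq (v ())) ^ (2 * L + p)) *
      ((∫⁻ b : κ → ℍ[ℝ], ENNReal.ofReal (1 / (1 + vecNormSq b) ^ p)) * quatMass κ L m) := by
    intro v
    obtain ⟨H, q, hH, hH', hv, hq⟩ := exists_householder (Sum.inl ()) (Matrix.of v)
    set r := vecNormSq (v ()) with hr
    have hr0 : 0 ≤ r := vecNormSq_nonneg _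
    set Q : Matrix Unit Unit ℍ[ℝ] := Matrix.of fun _ _ => q
    have hvQ : Matrix.of v * H = fromCols Q 0 := by
      rw [hv]
      ext1 i (j | j) <;> simp [Q]
    have hQ : Quaternion.normSq (Q () ()) = r := hq
    calc ∫⁻ B : κ → Unit ⊕ κ → ℍ[ℝ], ENNReal.ofReal
          (quatWeight L m (fromRows (Matrix.of v) (Matrix.of B)))
        = ∫⁻ B : κ → Unit ⊕ κ → ℍ[ℝ], ENNReal.ofReal
          (quatWeight L m (fromRows (fromCols Q 0) (Matrix.of (quatMulRight H B)))) := by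
          refine lintegral_congr fun B => ?_
          rw [← quatWeight_mul_involution L m _ H hH hH', fromRows_mul, hvQ]
          rfl
      _ = ∫⁻ B : κ → Unit ⊕ κ → ℍ[ℝ], ENNReal.ofReal
          (quatWeight L m (fromRows (fromCols Q 0) (Matrix.of B))) :=
          lintegral_comp_mul_involution hH (f := fun B => ENNReal.ofReal
            (quatWeight L m (fromRows (fromCols Q 0) (Matrix.of B))))
            ((hW.comp (hrows.comp (Continuous.prodMk_right (fromCols Q 0)))).measurable.ennreal_ofReal)
      _ = ∫⁻ b : κ → Unit → ℍ[ℝ], ∫⁻ A : κ → κ → ℍ[ℝ], ENNReal.ofReal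
          (quatWeight L m (fromBlocks Q 0 (Matrix.of b) (Matrix.of A))) := by
          rw [lintegral_fromCols (g := fun B => ENNReal.ofReal
            (quatWeight L m (fromRows (fromCols Q 0) B)))]
          · simp only [fromRows_fromCols_eq_fromBlocks]
          · simp only [fromRows_fromCols_eq_fromBlocks]
            exact (hW.comp (hblocks Q)).measurable.ennreal_ofReal
      _ = ENNReal.ofReal (Real.sqrt (1 + r) ^ (4 * Fintype.card κ)) *
          ∫⁻ b : κ → Unit → ℍ[ℝ], ∫⁻ A : κ → κ → ℍ[ℝ], ENNReal.ofReal
          (quatWeight L m (fromBlocks Q 0 (Matrix.of (Real.sqrt (1 + r) • b)) (Matrix.of A))) :=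
          lintegral_eq_pow_mul_lintegral_smul (Real.sqrt_pos.2 (by positivity))
            ((hW.comp (hblocks Q)).measurable.ennreal_ofReal.lintegral_prod_right')
      _ = ENNReal.ofReal (Real.sqrt (1 + r) ^ (4 * Fintype.card κ)) *
          ∫⁻ b : κ → Unit → ℍ[ℝ], ENNReal.ofReal (r ^ (2 * L) / (1 + r) ^ (2 * m)) *
            (ENNReal.ofReal (1 / (1 + vecNormSq fun i => b i ()) ^ p) * quatMass κ L m) := by
          congr 1
          refine lintegral_congr fun b => ?_
          have hb : _ = ENNReal.ofReal (1 / (1 + vecNormSq fun i => b i ()) ^ p) * quatMass κ L m :=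
            lintegral_quatDet_ratio L m p hm (Matrix.of b)
          rw [← hb, ← lintegral_const_mul' _ _ ENNReal.ofReal_ne_top]
          refine lintegral_congr fun A => ?_
          rw [← ENNReal.ofReal_mul (by positivity), quatWeight_fromBlocks L m Q _ _ hQ]
          have : (1 + r)⁻¹ • (Matrix.of (Real.sqrt (1 + r) • b) *
              (Matrix.of (Real.sqrt (1 + r) • b))ᴴ) = Matrix.of b * (Matrix.of b)ᴴ := by
            rw [← Matrix.smul_of, conjTranspose_real_smul, Matrix.smul_mul, Matrix.mul_smul,
              smul_smul, smul_smul, mul_assoc, Real.mul_self_sqrt (by positivity),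
              inv_mul_cancel₀ (by positivity), one_smul]
          rw [this]
      _ = _ := by
          rw [lintegral_const_mul' _ _ ENNReal.ofReal_ne_top, lintegral_mul_const, hcol, ← mul_assoc,
            ← ENNReal.ofReal_mul (by positivity), show 4 * Fintype.card κ = 2 * (2 * Fintype.card κ)
              by ring, pow_mul (Real.sqrt (1 + r)) 2, Real.sq_sqrt (by positivity), hm]
          · congr 2
            have : 0 < 1 + r := by positivity
            field_simp
            ring
          · have hb := volume_preserving_pi fun _ : κ => volume_preserving_funUnique Unit ℍ[ℝ]
            exact ((measurable_const.div ((measurable_const.add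
              (measurable_vecNormSq.comp hb.measurable)).pow_const _)).ennreal_ofReal)
  have hF : Measurable fun v : Unit ⊕ κ → ℍ[ℝ] => ENNReal.ofReal
      (vecNormSq v ^ (2 * L) / (1 + vecNormSq v) ^ (2 * L + p)) :=
    ((measurable_vecNormSq.pow_const _).div
      ((measurable_const.add measurable_vecNormSq).pow_const _)).ennreal_ofReal
  rw [quatMass, lintegral_fromRows (g := fun G => ENNReal.ofReal (quatWeight L m G))
    (hW.comp hrows).measurable.ennreal_ofReal]
  simp_rw [hinner]
  rw [lintegral_mul_const]
  · congr 1
    exact (volume_preserving_funUnique Unit (Unit ⊕ κ → ℍ[ℝ])).lintegral_comp (f := fun v =>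
      ENNReal.ofReal (vecNormSq v ^ (2 * L) / (1 + vecNormSq v) ^ (2 * L + p))) hF
  · exact hF.comp (measurable_pi_apply ())

end

theorem quatMass_fin (L N p : ℕ) :
    quatMass (Fin N) L (2 * N + L + p) = ENNReal.ofReal (Real.pi ^ (2 * N ^ 2) *
      ∏ j ∈ Finset.range N, ((2 * (L + j) + 1).factorial * (2 * (p + j) + 1).factorial : ℝ) /
        ((2 * j + 1).factorial * (2 * (N + p + L + j) + 1).factorial)) := by
  induction N generalizing p with
  | zero =>
    have : (volume : Measure (Fin 0 → Fin 0 → ℍ[ℝ])) Set.univ = 1 := by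
      rw [volume_pi, Measure.pi_univ]
      simp
    simp [quatMass, quatWeight, quatDet, this]
  | succ N ih =>
    have e : Fin (N + 1) ≃ Unit ⊕ Fin N := Fintype.equivOfCardEq (by simp [add_comm])
    rw [quatMass_congr e, quatMass_unit_sum L _ (2 * N + (2 * p + 3) + 1) (by simp; ring)]
    have h1 := lintegral_vecNormSq_pow_div (n := Unit ⊕ Fin N) (2 * L) (2 * p + 1)
    have h2 := lintegral_one_div_vecNormSq (n := Fin N) (2 * p + 3)
    have hc : Fintype.card (Unit ⊕ Fin N) = N + 1 := by simp [add_comm]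
    rw [hc] at h1
    rw [Fintype.card_fin] at h2
    rw [show 2 * L + (2 * N + (2 * p + 3) + 1) = 2 * (N + 1) + 2 * L + (2 * p + 1) + 1 by ring, h1,
      h2, show 2 * (N + 1) + L + p = 2 * N + L + (p + 2) by ring, ih,
      ← ENNReal.ofReal_mul (by positivity), ← ENNReal.ofReal_mul (by positivity)]
    congr 1
    simp only [Finset.prod_div_distrib, Finset.prod_mul_distrib]
    have hg : (∏ j ∈ Finset.range N, ((2 * (p + 2 + j) + 1).factorial : ℝ)) *
        ((2 * p + 3).factorial * (2 * p + 1).factorial) =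
        (∏ j ∈ Finset.range (N + 1), ((2 * (p + j) + 1).factorial : ℝ)) *
          (2 * N + (2 * p + 3)).factorial := by
      have h3 := Finset.prod_range_succ (fun j => ((2 * (p + j) + 1).factorial : ℝ)) (N + 1)
      rw [Finset.prod_range_succ', Finset.prod_range_succ'] at h3
      convert h3 using 1
      · rw [mul_assoc]
        congr 1
        refine Finset.prod_congr rfl fun j _ => ?_
        congr 2
        ring
      · congr 3
        ring
    have hh : ∏ j ∈ Finset.range (N + 1), ((2 * (N + 1 + p + L + j) + 1).factorial : ℝ) =
        (∏ j ∈ Finset.range N, ((2 * (N + (p + 2) + L + j) + 1).factorial : ℝ)) *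
          (2 * (N + 1) + 2 * L + (2 * p + 1)).factorial := by
      rw [Finset.prod_range_succ']
      congr 1
      · refine Finset.prod_congr rfl fun j _ => ?_
        congr 2
        ring
      · congr 2
        ring
    have hp : ∀ f : ℕ → ℕ, ∏ j ∈ Finset.range N, ((f j).factorial : ℝ) ≠ 0 := fun f =>
      Finset.prod_ne_zero_iff.2 fun j _ => by positivity
    rw [hh, Finset.prod_range_succ (fun j => ((2 * (L + j) + 1).factorial : ℝ)),
      Finset.prod_range_succ (fun j => ((2 * j + 1).factorial : ℝ)),
      show 2 * (N + 1) - 1 = 2 * N + 1 by omega, show 2 * N + 1 + 2 * L = 2 * (L + N) + 1 by ring,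
      show 2 * (N + 1) ^ 2 = 2 * (N + 1) + 2 * N + 2 * N ^ 2 by ring, pow_add, pow_add]
    have hq1 := hp fun j => 2 * j + 1
    have hq2 := hp fun j => 2 * (N + (p + 2) + L + j) + 1
    have hf : ∀ k : ℕ, (k.factorial : ℝ) ≠ 0 := fun k => by positivity
    have hq3 := hf (2 * N + 1)
    have hq4 := hf (2 * (N + 1) + 2 * L + (2 * p + 1))
    have hq5 := hf (2 * N + (2 * p + 3))
    generalize (∏ j ∈ Finset.range (N + 1), ((2 * (p + j) + 1).factorial : ℝ)) = P at *
    generalize (∏ j ∈ Finset.range N, ((2 * (p + 2 + j) + 1).factorial : ℝ)) = P' at *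
    generalize (∏ j ∈ Finset.range N, ((2 * j + 1).factorial : ℝ)) = Q at *
    generalize (∏ j ∈ Finset.range N, ((2 * (N + (p + 2) + L + j) + 1).factorial : ℝ)) = R at *
    generalize ((2 * N + 1).factorial : ℝ) = x at *
    generalize ((2 * (N + 1) + 2 * L + (2 * p + 1)).factorial : ℝ) = y at *
    generalize ((2 * N + (2 * p + 3)).factorial : ℝ) = z at *
    field_simp
    linear_combination hg

theorem measurePreserving_quatOfComplexPair_pi {ι : Type*} [Fintype ι] :
    MeasurePreserving (fun (p : (ι → ι → ℂ) × (ι → ι → ℂ)) (j k : ι) =>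
      quatOfComplexPair (p.1 j k, p.2 j k)) := by
  have : SigmaFinite (volume : Measure (ℂ × ℂ)) :=
    inferInstanceAs (SigmaFinite (Measure.prod volume volume))
  have h1 := (volume_measurePreserving_arrowProdEquivProdArrow (ι → ℂ) (ι → ℂ) ι).symm
  have h2 := volume_preserving_pi (β' := fun _ => ι → ℂ × ℂ) fun _ : ι =>
    (volume_measurePreserving_arrowProdEquivProdArrow ℂ ℂ ι).symm
  have h3 := volume_preserving_pi fun _ : ι => volume_preserving_pi fun _ : ι =>
    measurePreserving_quatOfComplexPair
  exact h3.comp (h2.comp h1)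

theorem integral_quatMat (N L m : ℕ) :
    ∫ p : (Fin N → Fin N → ℂ) × (Fin N → Fin N → ℂ),
      (quatMat N p.1 p.2 * (quatMat N p.1 p.2)ᴴ).det ^ L /
        (1 + quatMat N p.1 p.2 * (quatMat N p.1 p.2)ᴴ).det ^ m =
      ((quatMass (Fin N) L m).toReal : ℂ) := by
  have hmp := measurePreserving_quatOfComplexPair_pi (ι := Fin N)
  set Ψ := fun (p : (Fin N → Fin N → ℂ) × (Fin N → Fin N → ℂ)) (j k : Fin N) =>
      quatOfComplexPair (p.1 j k, p.2 j k) with hΨ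
  have hW : ∀ p : (Fin N → Fin N → ℂ) × (Fin N → Fin N → ℂ),
      (quatMat N p.1 p.2 * (quatMat N p.1 p.2)ᴴ).det ^ L /
        (1 + quatMat N p.1 p.2 * (quatMat N p.1 p.2)ᴴ).det ^ m =
      ((quatWeight L m (Matrix.of (Ψ p)) : ℝ) : ℂ) := by
    intro p
    have e : quatMat N p.1 p.2 = quatRep (Matrix.of (Ψ p)) := rfl
    rw [e, det_quatRep_mul_conjTranspose, (det_one_add_quatRep_mul_conjTranspose _).1, quatWeight,
      pow_mul]
    push_cast
    rfl
  have hc : Continuous fun G : Fin N → Fin N → ℍ[ℝ] => quatWeight L m (Matrix.of G) :=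
    continuous_quatWeight L m
  simp_rw [hW]
  rw [integral_complex_ofReal, integral_eq_lintegral_of_nonneg_ae
    (Filter.Eventually.of_forall fun p => quatWeight_nonneg L m _)
    (hc.measurable.comp hmp.measurable).aestronglyMeasurable, quatMass,
    ← hmp.lintegral_comp (measurable_ofReal_quatWeight L m)]

end

/-- Normalization of the matrix probability density of the real quaternion (β = 4)
induced spherical ensemble. -/
theorem normalization_induced_spherical_quaternion (N n L : ℕ) (hN : 1 ≤ N) (hn : N ≤ n) :
    ((Real.pi ^ (2*N^2))⁻¹ *
      ∏ j : Fin N,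
        Real.Gamma (2*((j:ℕ)+1)) * Real.Gamma (2*((n:ℝ)+L+(j:ℕ)+1)) /
          (Real.Gamma (2*((L:ℝ)+(j:ℕ)+1)) * Real.Gamma (2*((n:ℝ)-N+(j:ℕ)+1))) : ℂ) *
      ∫ p : (Fin N → Fin N → ℂ) × (Fin N → Fin N → ℂ),
        (quatMat N p.1 p.2 * (quatMat N p.1 p.2)ᴴ).det ^ L /
          (1 + quatMat N p.1 p.2 * (quatMat N p.1 p.2)ᴴ).det ^ (n + N + L) = 1 := by
  obtain ⟨p, rfl⟩ := Nat.exists_eq_add_of_le hn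
  rw [integral_quatMat, show N + p + N + L = 2 * N + L + p by ring, quatMass_fin,
    ENNReal.toReal_ofReal (by positivity), Finset.prod_range]
  have hG : ∀ (x : ℝ) (k : ℕ), x = k + 1 → Real.Gamma x = k.factorial := fun x k hx => by
    rw [hx, Real.Gamma_nat_eq_factorial]
  have h : ∀ j : Fin N, Real.Gamma (2*((j:ℕ)+1)) * Real.Gamma (2*(((N + p : ℕ):ℝ)+L+(j:ℕ)+1)) /
      (Real.Gamma (2*((L:ℝ)+(j:ℕ)+1)) * Real.Gamma (2*(((N + p : ℕ):ℝ)-N+(j:ℕ)+1))) =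
      (((2 * (L + j) + 1).factorial * (2 * (p + j) + 1).factorial : ℝ) /
        ((2 * (j : ℕ) + 1).factorial * (2 * (N + p + L + j) + 1).factorial))⁻¹ := by
    intro j
    rw [hG _ (2 * j + 1) (by push_cast; ring), hG _ (2 * (N + p + L + j) + 1) (by push_cast; ring),
      hG _ (2 * (L + j) + 1) (by push_cast; ring), hG _ (2 * (p + j) + 1) (by push_cast; ring),
      inv_div]
  have h' : (Real.pi ^ (2 * N ^ 2))⁻¹ * (∏ j : Fin N,
      Real.Gamma (2*((j:ℕ)+1)) * Real.Gamma (2*(((N + p : ℕ):ℝ)+L+(j:ℕ)+1)) /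
      (Real.Gamma (2*((L:ℝ)+(j:ℕ)+1)) * Real.Gamma (2*(((N + p : ℕ):ℝ)-N+(j:ℕ)+1)))) *
      (Real.pi ^ (2 * N ^ 2) * ∏ j : Fin N,
        ((2 * (L + j) + 1).factorial * (2 * (p + j) + 1).factorial : ℝ) /
        ((2 * (j : ℕ) + 1).factorial * (2 * (N + p + L + j) + 1).factorial)) = 1 := by
    rw [Finset.prod_congr rfl fun j _ => h j, Finset.prod_inv_distrib, ← mul_inv]
    exact inv_mul_cancel₀ (by positivity)
  exact_mod_cast congrArg (fun x : ℝ => (x : ℂ)) h'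
end

section
/- For integers N ≥ 1, L ≥ 0 and n ≥ N, ∫_{[0,1]^N} ∏_{j=1}^{N} t_j^{2L+1} (1−t_j)^{2(n−N)+1} ∏_{1≤j<k≤N} (t_k − t_j)^4 dt_1 ⋯ dt_N = ∏_{j=1}^{N} Γ(2(L+j)) Γ(2(n−N+j)) Γ(2j+1) / (Γ(2(L+n+j)) Γ(3)). -/
open MeasureTheory

/-- The product over pairs `j < k` of `(t k - t j) ^ 4`. -/
def vandermondePowFour {N : ℕ} (t : Fin N → ℝ) : ℝ :=
  ∏ j : Fin N, ∏ k : Fin N, (if j < k then (t k - t j) ^ 4 else 1)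

/-- The Selberg density with exponents `a` and `b`, at `γ = 2`. -/
def selbergDensity (a b : ℕ) {N : ℕ} (t : Fin N → ℝ) : ℝ :=
  (∏ j : Fin N, (t j) ^ a * (1 - t j) ^ b) * vandermondePowFour t

theorem continuous_selbergDensity (a b N : ℕ) :
    Continuous (selbergDensity a b : (Fin N → ℝ) → ℝ) := by
  unfold selbergDensity vandermondePowFour
  refine .mul (by fun_prop) (continuous_finsetProd _ fun j _ =>
    continuous_finsetProd _ fun k _ => ?_)
  split_ifs <;> fun_prop

theorem vandermondePowFour_eq_det {N : ℕ} (t : Fin N → ℝ) :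
    vandermondePowFour t = (Matrix.vandermonde t).det ^ 4 := by
  rw [Matrix.det_vandermonde, ← Finset.prod_pow]
  refine Finset.prod_congr rfl fun j _ => ?_
  rw [← Finset.prod_pow, Finset.prod_ite, Finset.prod_const_one, mul_one]
  refine Finset.prod_congr ?_ fun _ _ => rfl
  ext k; simp

theorem vandermondePowFour_comp_perm {N : ℕ} (σ : Equiv.Perm (Fin N)) (t : Fin N → ℝ) :
    vandermondePowFour (t ∘ σ) = vandermondePowFour t := by
  have h : Matrix.vandermonde (t ∘ σ) = (Matrix.vandermonde t).submatrix σ id := rfl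
  rw [vandermondePowFour_eq_det, vandermondePowFour_eq_det, h, Matrix.det_permute, mul_pow]
  rcases Int.units_eq_one_or (Equiv.Perm.sign σ) with h | h <;> norm_num [h]

theorem selbergDensity_comp_perm (a b : ℕ) {N : ℕ} (σ : Equiv.Perm (Fin N)) (t : Fin N → ℝ) :
    selbergDensity a b (t ∘ σ) = selbergDensity a b t := by
  unfold selbergDensity
  rw [vandermondePowFour_comp_perm]
  congr 1
  exact Equiv.prod_comp σ (fun j => (t j) ^ a * (1 - t j) ^ b)

theorem selbergDensity_cons (a b : ℕ) {N : ℕ} (x : ℝ) (y : Fin N → ℝ) :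
    selbergDensity a b (Fin.cons x y : Fin (N + 1) → ℝ) =
      x ^ a * (1 - x) ^ b * (∏ j, (x - y j) ^ 4) * selbergDensity a b y := by
  have h : ∀ j, (y j - x) ^ 4 = (x - y j) ^ 4 := fun j => by ring
  simp [selbergDensity, vandermondePowFour, Fin.prod_univ_succ, h]
  ring

theorem setIntegral_Icc_comp_perm {N : ℕ} (σ : Equiv.Perm (Fin N)) (g : (Fin N → ℝ) → ℝ) :
    ∫ t in Set.Icc (0 : Fin N → ℝ) 1, g (t ∘ σ) = ∫ t in Set.Icc (0 : Fin N → ℝ) 1, g t := by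
  have h := volume_measurePreserving_piCongrLeft (fun _ : Fin N => ℝ) σ.symm
  have h2 := h.setIntegral_preimage_emb (MeasurableEquiv.measurableEmbedding _) g (Set.Icc 0 1)
  have h3 : ∀ t : Fin N → ℝ, MeasurableEquiv.piCongrLeft (fun _ : Fin N => ℝ) σ.symm t = t ∘ σ := by
    intro t
    ext i
    obtain ⟨j, rfl⟩ := σ.symm.surjective i
    rw [MeasurableEquiv.coe_piCongrLeft, Equiv.piCongrLeft_apply_apply]
    simp
  have h4 : (MeasurableEquiv.piCongrLeft (fun _ : Fin N => ℝ) σ.symm) ⁻¹' Set.Icc 0 1 =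
      Set.Icc (0 : Fin N → ℝ) 1 := by
    ext t
    simp only [Set.mem_preimage, h3, Set.mem_Icc, Pi.le_def]
    simp only [Function.comp_apply, Pi.zero_apply, Pi.one_apply]
    rw [σ.forall_congr_left (p := fun i => 0 ≤ t (σ i)),
      σ.forall_congr_left (p := fun i => t (σ i) ≤ 1)]
    simp
  simp only [h4, h3] at h2
  exact h2

theorem setIntegral_Icc_fin_succ {N : ℕ} (g : (Fin (N + 1) → ℝ) → ℝ) (hg : Continuous g) :
    ∫ t in Set.Icc (0 : Fin (N + 1) → ℝ) 1, g t =
      ∫ y in Set.Icc (0 : Fin N → ℝ) 1, ∫ x in (0 : ℝ)..1, g (Fin.cons x y) := by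
  have h := (volume_preserving_piFinSuccAbove (fun _ : Fin (N + 1) => ℝ) 0).symm
  have h2 := h.setIntegral_preimage_emb (MeasurableEquiv.measurableEmbedding _) g (Set.Icc 0 1)
  have h3 : ∀ p : ℝ × (Fin N → ℝ),
      (MeasurableEquiv.piFinSuccAbove (fun _ : Fin (N + 1) => ℝ) 0).symm p = Fin.cons p.1 p.2 := by
    intro p
    simp [MeasurableEquiv.piFinSuccAbove, Fin.consEquiv]
  have h4 : (MeasurableEquiv.piFinSuccAbove (fun _ : Fin (N + 1) => ℝ) 0).symm ⁻¹' Set.Icc 0 1 =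
      Set.Icc (0 : ℝ) 1 ×ˢ Set.Icc (0 : Fin N → ℝ) 1 := by
    ext p
    simp only [Set.mem_preimage, h3, Set.mem_Icc, Pi.le_def, Set.mem_prod, Fin.forall_fin_succ]
    simp
    tauto
  simp only [h4, h3] at h2
  rw [← h2, Measure.volume_eq_prod,
    ← setIntegral_prod_swap _ _ (fun p : ℝ × (Fin N → ℝ) => g (Fin.cons p.1 p.2)), setIntegral_prod]
  · refine setIntegral_congr_fun measurableSet_Icc fun y _ => ?_
    simp only [Prod.swap]
    rw [intervalIntegral.integral_of_le zero_le_one, integral_Icc_eq_integral_Ioc]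
  · rw [← Measure.volume_eq_prod]
    refine ContinuousOn.integrableOn_compact (isCompact_Icc.prod isCompact_Icc) ?_
    refine Continuous.continuousOn ?_
    simp only [Prod.fst_swap, Prod.snd_swap]
    fun_prop

theorem setIntegral_Icc_of_hasDerivAt {N : ℕ} (f : ℝ → (Fin N → ℝ) → ℝ)
    (f' : (Fin (N + 1) → ℝ) → ℝ) (hf' : Continuous f')
    (h : ∀ x y, HasDerivAt (fun x => f x y) (f' (Fin.cons x y)) x) :
    ∫ t in Set.Icc (0 : Fin (N + 1) → ℝ) 1, f' t =
      ∫ y in Set.Icc (0 : Fin N → ℝ) 1, (f 1 y - f 0 y) := by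
  rw [setIntegral_Icc_fin_succ f' hf']
  refine setIntegral_congr_fun measurableSet_Icc fun y _ => ?_
  refine intervalIntegral.integral_eq_sub_of_hasDerivAt (fun x _ => h x y) ?_
  apply Continuous.intervalIntegrable
  fun_prop

/-- The Selberg density divided by `t 0 - t j.succ`. -/
noncomputable def selbergQuotient (a b : ℕ) {n : ℕ} (j : Fin n) (t : Fin (n + 1) → ℝ) : ℝ :=
  selbergDensity a b t / (t 0 - t j.succ)

theorem selbergDensity_eq_mul_tail (a b : ℕ) {n : ℕ} (t : Fin (n + 1) → ℝ) :
    selbergDensity a b t = (t 0) ^ a * (1 - t 0) ^ b * (∏ j : Fin n, (t 0 - t j.succ) ^ 4) *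
      selbergDensity a b (Fin.tail t) := by
  conv_lhs => rw [← Fin.cons_self_tail t, selbergDensity_cons]
  rfl

theorem selbergQuotient_eq (a b : ℕ) {n : ℕ} (j : Fin n) (t : Fin (n + 1) → ℝ) :
    selbergQuotient a b j t = (t 0) ^ a * (1 - t 0) ^ b *
      ((t 0 - t j.succ) ^ 3 * ∏ k ∈ Finset.univ.erase j, (t 0 - t k.succ) ^ 4) *
      selbergDensity a b (Fin.tail t) := by
  rw [selbergQuotient, selbergDensity_eq_mul_tail,
    ← Finset.mul_prod_erase Finset.univ _ (Finset.mem_univ j)]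
  rcases eq_or_ne (t 0 - t j.succ) 0 with h | h
  · simp [h]
  · field_simp

theorem continuous_selbergQuotient (a b : ℕ) {n : ℕ} (j : Fin n) :
    Continuous (selbergQuotient a b j) := by
  have h : selbergQuotient a b j = _ := funext (selbergQuotient_eq a b j)
  rw [h]
  have := continuous_selbergDensity a b n
  have h2 : Continuous (fun t : Fin (n + 1) → ℝ => Fin.tail t) := by unfold Fin.tail; fun_prop
  fun_prop

theorem sub_mul_selbergQuotient (a b : ℕ) {n : ℕ} (j : Fin n) (t : Fin (n + 1) → ℝ) :
    (t 0 - t j.succ) * selbergQuotient a b j t = selbergDensity a b t := by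
  rcases eq_or_ne (t 0 - t j.succ) 0 with h | h
  · rw [selbergDensity_eq_mul_tail, Finset.prod_eq_zero (Finset.mem_univ j) (by simp [h]), h]
    simp
  · exact mul_div_cancel₀ _ h

theorem selbergQuotient_comp_swap (a b : ℕ) {n : ℕ} (j : Fin n) (t : Fin (n + 1) → ℝ) :
    selbergQuotient a b j (t ∘ Equiv.swap 0 j.succ) = -selbergQuotient a b j t := by
  rw [selbergQuotient, selbergQuotient, selbergDensity_comp_perm, ← div_neg]
  simp

theorem two_mul_setIntegral_selbergQuotient (a b : ℕ) {n : ℕ} (j : Fin n)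
    {p q : (Fin (n + 1) → ℝ) → ℝ} (hp : Continuous p)
    (h : ∀ t, p t - p (t ∘ Equiv.swap 0 j.succ) = (t 0 - t j.succ) * q t) :
    2 * ∫ t in Set.Icc (0 : Fin (n + 1) → ℝ) 1, p t * selbergQuotient a b j t =
      ∫ t in Set.Icc (0 : Fin (n + 1) → ℝ) 1, q t * selbergDensity a b t := by
  have hq := continuous_selbergQuotient a b j
  have hs : Continuous fun t : Fin (n + 1) → ℝ => t ∘ Equiv.swap 0 j.succ := by fun_prop
  rw [two_mul]
  nth_rw 2 [← setIntegral_Icc_comp_perm (Equiv.swap 0 j.succ)]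
  rw [← integral_add]
  · refine integral_congr_ae (.of_forall fun t => ?_)
    simp only
    rw [selbergQuotient_comp_swap, ← sub_mul_selbergQuotient a b j]
    linear_combination h t * selbergQuotient a b j t
  · exact (by fun_prop : Continuous _).integrableOn_Icc
  · exact (by fun_prop : Continuous _).integrableOn_Icc

theorem setIntegral_selbergDensity_by_parts (a b : ℕ) {n : ℕ} {m : (Fin n → ℝ) → ℝ}
    (hm : Continuous m) {r s : ℝ → ℝ} (hr : Continuous r) (hs : Continuous s)
    (h : ∀ x, HasDerivAt (fun x => r x * (x ^ a * (1 - x) ^ b)) (s x * (x ^ a * (1 - x) ^ b)) x) :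
    (∫ t in Set.Icc (0 : Fin (n + 1) → ℝ) 1, m (Fin.tail t) * s (t 0) * selbergDensity a b t) +
      4 * ∑ j, ∫ t in Set.Icc (0 : Fin (n + 1) → ℝ) 1,
        m (Fin.tail t) * r (t 0) * selbergQuotient a b j t =
    ∫ y in Set.Icc (0 : Fin n → ℝ) 1, m y *
      (r 1 * selbergDensity a b (Fin.cons 1 y : Fin (n + 1) → ℝ) -
      r 0 * selbergDensity a b (Fin.cons 0 y : Fin (n + 1) → ℝ)) := by
  have hd := continuous_selbergDensity a b (n + 1)
  have hq := continuous_selbergQuotient (n := n) a b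
  have h2 : Continuous (fun t : Fin (n + 1) → ℝ => Fin.tail t) := by unfold Fin.tail; fun_prop
  rw [← integral_finsetSum, ← integral_const_mul, ← integral_add]
  · rw [setIntegral_Icc_of_hasDerivAt (fun x y =>
      m y * (r x * selbergDensity a b (Fin.cons x y : Fin (n + 1) → ℝ)))]
    · refine integral_congr_ae (.of_forall fun t => ?_)
      simp only
      ring
    · fun_prop
    · intro x y
      have h3 : HasDerivAt (fun x => ∏ j, (x - y j) ^ 4)
          (∑ j, (∏ k ∈ Finset.univ.erase j, (x - y k) ^ 4) • (4 * (x - y j) ^ 3)) x := by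
        refine HasDerivAt.fun_finsetProd fun j _ => ?_
        simpa using ((hasDerivAt_id x).sub_const (y j)).fun_pow 4
      have h4 := ((h x).mul h3).mul_const (m y * selbergDensity a b y)
      convert! h4 using 1
      · ext x
        simp only [selbergDensity_cons, Pi.mul_apply]
        ring
      · simp only [selbergDensity_cons, selbergQuotient_eq, Fin.tail_cons, Fin.cons_zero,
          Fin.cons_succ, Finset.mul_sum, add_mul, Finset.sum_mul, smul_eq_mul]
        congr 1
        · ring
        · refine Finset.sum_congr rfl fun j _ => ?_
          ring
  · exact (by fun_prop : Continuous _).integrableOn_Icc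
  · exact (by fun_prop : Continuous _).integrableOn_Icc
  · intro j _
    exact (by fun_prop : Continuous _).integrableOn_Icc

theorem prod_comp_swap_of_mem {n : ℕ} {T : Finset (Fin n)} {j : Fin n} (hj : j ∈ T)
    (t : Fin (n + 1) → ℝ) :
    t j.succ * ∏ i ∈ T, (t ∘ Equiv.swap 0 j.succ) i.succ = t 0 * ∏ i ∈ T, t i.succ := by
  rw [← Finset.mul_prod_erase T _ hj, ← Finset.mul_prod_erase T (fun i => t i.succ) hj]
  have : ∏ i ∈ T.erase j, (t ∘ Equiv.swap 0 j.succ) i.succ = ∏ i ∈ T.erase j, t i.succ := by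
    refine Finset.prod_congr rfl fun i hi => ?_
    rw [Function.comp_apply, Equiv.swap_apply_of_ne_of_ne (Fin.succ_ne_zero i)]
    exact fun h => Finset.ne_of_mem_erase hi (Fin.succ_injective _ h)
  rw [this]
  simp
  ring

theorem prod_comp_swap_of_notMem {n : ℕ} {T : Finset (Fin n)} {j : Fin n} (hj : j ∉ T)
    (t : Fin (n + 1) → ℝ) :
    ∏ i ∈ T, (t ∘ Equiv.swap 0 j.succ) i.succ = ∏ i ∈ T, t i.succ := by
  refine Finset.prod_congr rfl fun i hi => ?_
  rw [Function.comp_apply, Equiv.swap_apply_of_ne_of_ne (Fin.succ_ne_zero i)]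
  exact fun h => hj (Fin.succ_injective _ h ▸ hi)

/-- The integral of the Selberg density against the monomial `∏ i ∈ s, t i`. -/
noncomputable def selbergMoment (a b : ℕ) {N : ℕ} (s : Finset (Fin N)) : ℝ :=
  ∫ t in Set.Icc (0 : Fin N → ℝ) 1, (∏ i ∈ s, t i) * selbergDensity a b t

theorem setIntegral_prod_succ_mul_selbergDensity (a b : ℕ) {n : ℕ} (T : Finset (Fin n)) :
    ∫ t in Set.Icc (0 : Fin (n + 1) → ℝ) 1, (∏ i ∈ T, t i.succ) * selbergDensity a b t =
      selbergMoment a b (T.map (Fin.succEmb n)) := by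
  simp [selbergMoment]

theorem setIntegral_mul_prod_succ_mul_selbergDensity (a b : ℕ) {n : ℕ} {T : Finset (Fin n)}
    {j : Fin n} (hj : j ∉ T) :
    ∫ t in Set.Icc (0 : Fin (n + 1) → ℝ) 1,
        (t 0 * ∏ i ∈ T, t i.succ) * selbergDensity a b t =
      selbergMoment a b ((insert j T).map (Fin.succEmb n)) := by
  rw [← setIntegral_prod_succ_mul_selbergDensity,
    ← setIntegral_Icc_comp_perm (Equiv.swap 0 j.succ)]
  refine integral_congr_ae (.of_forall fun t => ?_)
  simp only
  rw [prod_comp_swap_of_notMem hj, selbergDensity_comp_perm, Finset.prod_insert hj]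
  simp

/-- Aomoto's recursion between consecutive moments. -/
theorem aomoto_recursion (a b : ℕ) {n : ℕ} (T : Finset (Fin n)) :
    ((a : ℝ) + 1 + 2 * (n - T.card)) * ∫ t in Set.Icc (0 : Fin (n + 1) → ℝ) 1,
        (∏ i ∈ T, t i.succ) * selbergDensity a b t =
      ((a : ℝ) + b + 2 + 2 * (2 * n - T.card)) * ∫ t in Set.Icc (0 : Fin (n + 1) → ℝ) 1,
        (t 0 * ∏ i ∈ T, t i.succ) * selbergDensity a b t := by
  have hd := continuous_selbergDensity a b (n + 1)
  set A := ∫ t in Set.Icc (0 : Fin (n + 1) → ℝ) 1,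
        (∏ i ∈ T, t i.succ) * selbergDensity a b t with hA
  set B := ∫ t in Set.Icc (0 : Fin (n + 1) → ℝ) 1,
        (t 0 * ∏ i ∈ T, t i.succ) * selbergDensity a b t with hB
  have key := setIntegral_selbergDensity_by_parts a b (m := fun y => ∏ i ∈ T, y i)
    (r := fun x => x * (1 - x)) (s := fun x => (a + 1) * (1 - x) - (b + 1) * x)
    (by fun_prop) (by fun_prop) (by fun_prop) (fun x => by
      have h := (hasDerivAt_pow (a + 1) x).mul (((hasDerivAt_id x).const_sub 1).fun_pow (b + 1))
      convert! h using 1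
      · ext x
        simp
        ring
      · simp
        ring)
  simp only [sub_self, mul_zero, zero_mul, integral_zero] at key
  have h1 : ∫ t in Set.Icc (0 : Fin (n + 1) → ℝ) 1, (∏ i ∈ T, Fin.tail t i) *
      ((a + 1) * (1 - t 0) - (b + 1) * t 0) * selbergDensity a b t =
      (a + 1) * A - (a + b + 2) * B := by
    rw [hA, hB, ← integral_const_mul, ← integral_const_mul, ← integral_sub]
    · refine integral_congr_ae (.of_forall fun t => ?_)
      simp only [Fin.tail]
      ring
    · exact (by fun_prop : Continuous _).integrableOn_Icc
    · exact (by fun_prop : Continuous _).integrableOn_Icc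
  have h2 : ∀ j, 2 * ∫ t in Set.Icc (0 : Fin (n + 1) → ℝ) 1, (∏ i ∈ T, Fin.tail t i) *
      (t 0 * (1 - t 0)) * selbergQuotient a b j t = if j ∈ T then -B else A - 2 * B := by
    intro j
    have hp : Continuous fun t : Fin (n + 1) → ℝ => (∏ i ∈ T, Fin.tail t i) *
      (t 0 * (1 - t 0)) := by unfold Fin.tail; fun_prop
    split_ifs with hj
    · rw [two_mul_setIntegral_selbergQuotient a b j hp (q := fun t => -(t 0 * ∏ i ∈ T, t i.succ)),
        hB, ← integral_neg]
      · simp only [neg_mul]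
      · intro t
        have := prod_comp_swap_of_mem hj t
        simp only [Fin.tail, Function.comp_apply, Equiv.swap_apply_left] at this ⊢
        linear_combination -(1 - t j.succ) * this
    · rw [two_mul_setIntegral_selbergQuotient a b j hp
        (q := fun t => (1 - t 0 - t j.succ) * ∏ i ∈ T, t i.succ)]
      · have hB' : B = ∫ t in Set.Icc (0 : Fin (n + 1) → ℝ) 1,
            (t j.succ * ∏ i ∈ T, t i.succ) * selbergDensity a b t := by
          rw [hB, setIntegral_mul_prod_succ_mul_selbergDensity a b hj,
            ← setIntegral_prod_succ_mul_selbergDensity]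
          simp only [Finset.prod_insert hj]
        rw [two_mul, ← sub_sub]
        nth_rw 2 [hB']
        rw [hA, hB, ← integral_sub, ← integral_sub]
        · refine integral_congr_ae (.of_forall fun t => ?_)
          simp only
          ring
        all_goals exact (by fun_prop : Continuous _).integrableOn_Icc
      · intro t
        have := prod_comp_swap_of_notMem hj t
        simp only [Fin.tail, Function.comp_apply, Equiv.swap_apply_left] at this ⊢
        rw [this]
        ring
  have h3 := Finset.sum_congr (rfl : Finset.univ = Finset.univ) fun j (_ : j ∈ Finset.univ) => h2 j
  rw [← Finset.mul_sum, Finset.sum_ite] at h3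
  have hc : (Finset.univ.filter fun j => j ∉ T).card = (n : ℝ) - T.card := by
    have : (Finset.univ.filter fun j => j ∉ T) = Tᶜ := by ext; simp
    rw [this, Finset.card_compl, Fintype.card_fin, Nat.cast_sub (by simpa using T.card_le_univ)]
  simp only [Finset.sum_const, nsmul_eq_mul, hc, Finset.filter_univ_mem] at h3
  rw [h1] at key
  linear_combination key - 2 * h3

theorem selbergMoment_recursion (a b : ℕ) {n : ℕ} (T : Finset (Fin n)) :
    ((a : ℝ) + 1 + 2 * (n - T.card)) * selbergMoment a b (T.map (Fin.succEmb n)) =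
      ((a : ℝ) + b + 2 + 2 * (2 * n - T.card)) *
        selbergMoment a b (insert 0 (T.map (Fin.succEmb n))) := by
  have h := aomoto_recursion a b T
  rw [setIntegral_prod_succ_mul_selbergDensity] at h
  rw [h, selbergMoment]
  simp [Finset.prod_insert]

theorem selbergMoment_zero_mul (b n : ℕ) :
    ((b : ℝ) + 1 + 2 * n) * selbergMoment 0 b (∅ : Finset (Fin (n + 1))) =
      selbergMoment 4 b (∅ : Finset (Fin n)) := by
  have key := setIntegral_selbergDensity_by_parts 0 b (n := n) (m := fun _ => 1)
    (r := fun x => 1 - x) (s := fun _ => -(b + 1))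
    (by fun_prop) (by fun_prop) (by fun_prop) (fun x => by
      have h := (((hasDerivAt_id x).const_sub 1).fun_pow (b + 1))
      convert! h using 1
      · ext x
        simp
        ring
      · simp
        ring)
  have h2 : ∀ j : Fin n, 2 * ∫ t in Set.Icc (0 : Fin (n + 1) → ℝ) 1, 1 *
      (1 - t 0) * selbergQuotient 0 b j t = -selbergMoment 0 b (∅ : Finset (Fin (n + 1))) := by
    intro j
    rw [two_mul_setIntegral_selbergQuotient 0 b j (by fun_prop) (q := fun _ => -1), selbergMoment,
      ← integral_neg]
    · simp
    · intro t
      simp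
  have h3 := Finset.sum_congr (rfl : Finset.univ = Finset.univ) fun j (_ : j ∈ Finset.univ) => h2 j
  rw [← Finset.mul_sum] at h3
  simp only [Finset.sum_const, Finset.card_univ, Fintype.card_fin, nsmul_eq_mul] at h3
  have h4 : ∀ y : Fin n → ℝ, selbergDensity 0 b (Fin.cons 0 y : Fin (n + 1) → ℝ) =
      selbergDensity 4 b y := by
    intro y
    rw [selbergDensity_cons]
    simp [selbergDensity, Finset.prod_mul_distrib, Even.neg_pow (by decide : Even 4)]
    ring
  simp only [h4] at key
  have h5 : ∫ t in Set.Icc (0 : Fin (n + 1) → ℝ) 1, 1 * -((b : ℝ) + 1) * selbergDensity 0 b t =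
      -(b + 1) * selbergMoment 0 b (∅ : Finset (Fin (n + 1))) := by
    rw [selbergMoment, ← integral_const_mul]
    simp
  have h6 : ∫ y in Set.Icc (0 : Fin n → ℝ) 1, 1 * ((1 - 1) *
      selbergDensity 0 b (Fin.cons 1 y : Fin (n + 1) → ℝ) - (1 - 0) * selbergDensity 4 b y) =
      -selbergMoment 4 b (∅ : Finset (Fin n)) := by
    rw [selbergMoment, ← integral_neg]
    simp
  rw [h5, h6] at key
  linear_combination -key + 2 * h3

theorem selbergMoment_map_succ_mul (a b : ℕ) {n : ℕ} (T : Finset (Fin n)) :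
    selbergMoment a b (T.map (Fin.succEmb n)) *
        ∏ i ∈ Finset.range T.card, ((a : ℝ) + b + 2 + 2 * (2 * n - i)) =
      selbergMoment a b (∅ : Finset (Fin (n + 1))) *
        ∏ i ∈ Finset.range T.card, ((a : ℝ) + 1 + 2 * (n - i)) := by
  induction T using Finset.induction_on with
  | empty => simp
  | insert j T hj ih =>
    have h := aomoto_recursion a b T
    rw [setIntegral_prod_succ_mul_selbergDensity,
      setIntegral_mul_prod_succ_mul_selbergDensity a b hj] at h
    rw [Finset.card_insert_of_notMem hj, Finset.prod_range_succ, Finset.prod_range_succ]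
    linear_combination ((a : ℝ) + 1 + 2 * (n - T.card)) * ih -
      (∏ i ∈ Finset.range T.card, ((a : ℝ) + b + 2 + 2 * (2 * n - i))) * h

theorem selbergMoment_univ (a b N : ℕ) :
    selbergMoment a b (Finset.univ : Finset (Fin N)) =
      selbergMoment (a + 1) b (∅ : Finset (Fin N)) := by
  simp only [selbergMoment, selbergDensity, ← mul_assoc, ← Finset.prod_mul_distrib,
    Finset.prod_empty, one_mul, pow_succ']

theorem selbergMoment_succ_mul (a b n : ℕ) :
    selbergMoment (a + 1) b (∅ : Finset (Fin (n + 1))) *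
        ∏ j ∈ Finset.range (n + 1), ((a : ℝ) + b + 2 + 2 * (n + j)) =
      selbergMoment a b (∅ : Finset (Fin (n + 1))) *
        ∏ j ∈ Finset.range (n + 1), ((a : ℝ) + 1 + 2 * j) := by
  have h := selbergMoment_map_succ_mul a b (Finset.univ : Finset (Fin n))
  have h2 := selbergMoment_recursion a b (Finset.univ : Finset (Fin n))
  have h3 : insert 0 ((Finset.univ : Finset (Fin n)).map (Fin.succEmb n)) = Finset.univ := by
    rw [Fin.univ_succ, Finset.cons_eq_insert]
    rfl
  rw [h3, selbergMoment_univ] at h2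
  rw [Finset.card_univ, Fintype.card_fin] at h h2
  have e1 : ∏ j ∈ Finset.range (n + 1), ((a : ℝ) + b + 2 + 2 * (n + j)) =
      ∏ i ∈ Finset.range (n + 1), ((a : ℝ) + b + 2 + 2 * (2 * n - i)) := by
    rw [← Finset.prod_range_reflect]
    refine Finset.prod_congr rfl fun i hi => ?_
    rw [Nat.add_sub_cancel, Nat.cast_sub (Finset.mem_range_succ_iff.mp hi)]
    ring
  have e2 : ∏ j ∈ Finset.range (n + 1), ((a : ℝ) + 1 + 2 * j) =
      ∏ i ∈ Finset.range (n + 1), ((a : ℝ) + 1 + 2 * (n - i)) := by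
    rw [← Finset.prod_range_reflect]
    refine Finset.prod_congr rfl fun i hi => ?_
    rw [Nat.add_sub_cancel, Nat.cast_sub (Finset.mem_range_succ_iff.mp hi)]
  rw [e1, e2, Finset.prod_range_succ, Finset.prod_range_succ]
  linear_combination ((a : ℝ) + 1 + 2 * (n - n)) * h -
    (∏ i ∈ Finset.range n, ((a : ℝ) + b + 2 + 2 * (2 * n - i))) * h2

/-- The closed form of the Selberg integral at `γ = 2` with natural exponents. -/
noncomputable def selbergValue (a b N : ℕ) : ℝ :=
  ∏ j ∈ Finset.range N, ((a + 2 * j).factorial * (b + 2 * j).factorial * (2 * j + 2).factorial /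
    ((a + b + 2 * (N + j) - 1).factorial * 2) : ℝ)

theorem selbergValue_succ_mul (a b n : ℕ) :
    selbergValue (a + 1) b (n + 1) *
        ∏ j ∈ Finset.range (n + 1), ((a : ℝ) + b + 2 + 2 * (n + j)) =
      selbergValue a b (n + 1) * ∏ j ∈ Finset.range (n + 1), ((a : ℝ) + 1 + 2 * j) := by
  rw [selbergValue, selbergValue, ← Finset.prod_mul_distrib, ← Finset.prod_mul_distrib]
  refine Finset.prod_congr rfl fun j _ => ?_
  have e1 : a + 1 + b + 2 * (n + 1 + j) - 1 = (a + b + 2 * (n + j) + 1) + 1 := by omega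
  have e2 : a + b + 2 * (n + 1 + j) - 1 = a + b + 2 * (n + j) + 1 := by omega
  have e3 : a + 1 + 2 * j = (a + 2 * j) + 1 := by omega
  rw [e1, e2, e3, Nat.factorial_succ (a + b + 2 * (n + j) + 1), Nat.factorial_succ (a + 2 * j)]
  have := Nat.factorial_ne_zero (a + b + 2 * (n + j) + 1)
  push_cast
  have h : (a : ℝ) + b + 2 * (n + j) + 1 + 1 ≠ 0 := by positivity
  field_simp
  ring

theorem selbergValue_zero_mul (b n : ℕ) :
    ((b : ℝ) + 1 + 2 * n) * selbergValue 0 b (n + 1) = selbergValue 4 b n := by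
  have hf : ∀ k : ℕ, (k.factorial : ℝ) ≠ 0 := fun k => by positivity
  have e1 : ∀ j, 0 + b + 2 * (n + 1 + j) - 1 = b + 2 * (n + j) + 1 := by omega
  have e2 : ∀ j ∈ Finset.range n, 4 + b + 2 * (n + j) - 1 = b + 2 * (n + (j + 1)) + 1 := by
    intro j _; omega
  have hD : ∏ j ∈ Finset.range n, ((4 + b + 2 * (n + j) - 1).factorial : ℝ) =
      ∏ j ∈ Finset.range n, ((b + 2 * (n + (j + 1)) + 1).factorial : ℝ) :=
    Finset.prod_congr rfl fun j hj => by rw [e2 j hj]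
  have hE : (∏ j ∈ Finset.range n, ((2 * j + 2).factorial : ℝ)) * (2 * n + 2).factorial =
      (∏ j ∈ Finset.range n, ((4 + 2 * j).factorial : ℝ)) * 2 := by
    rw [← Finset.prod_range_succ (fun j => ((2 * j + 2).factorial : ℝ)), Finset.prod_range_succ']
    congr 1
    refine Finset.prod_congr rfl fun j _ => ?_
    rw [show 2 * (j + 1) + 2 = 4 + 2 * j by ring]
  have hF : ∏ j ∈ Finset.range (n + 1), ((0 + 2 * j).factorial : ℝ) =
      ∏ j ∈ Finset.range n, ((2 * j + 2).factorial : ℝ) := by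
    rw [Finset.prod_range_succ']
    simp [mul_add]
  have hG : ∏ j ∈ Finset.range (n + 1), ((b + 2 * (n + j) + 1).factorial : ℝ) =
      (∏ j ∈ Finset.range n, ((b + 2 * (n + (j + 1)) + 1).factorial : ℝ)) *
        ((b + 2 * n + 1) * (b + 2 * n).factorial) := by
    rw [Finset.prod_range_succ', Nat.add_zero, Nat.factorial_succ]
    push_cast
    simp only [add_zero]
  simp only [selbergValue, Finset.prod_div_distrib, Finset.prod_mul_distrib, hD, e1, hF, hG]
  rw [Finset.prod_range_succ, Finset.prod_range_succ, Finset.prod_range_succ]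
  have hp : ∏ j ∈ Finset.range n, ((b + 2 * (n + (j + 1)) + 1).factorial : ℝ) ≠ 0 :=
    Finset.prod_ne_zero_iff.mpr fun j _ => hf _
  have hb : (b : ℝ) + 2 * n + 1 ≠ 0 := by positivity
  have hb' := hf (b + 2 * n)
  rw [mul_div_assoc', div_eq_div_iff (by positivity) (by positivity)]
  linear_combination ((b : ℝ) + 1 + 2 * n) * (b + 2 * n).factorial *
    (∏ j ∈ Finset.range n, ((2 * j + 2).factorial : ℝ)) *
    (∏ j ∈ Finset.range n, ((b + 2 * j).factorial : ℝ)) *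
    (∏ j ∈ Finset.range n, ((b + 2 * (n + (j + 1)) + 1).factorial : ℝ)) *
    (∏ _j ∈ Finset.range n, (2 : ℝ)) * hE

/-- The Selberg integral at `γ = 2` with natural exponents. -/
theorem selbergMoment_empty (a b N : ℕ) :
    selbergMoment a b (∅ : Finset (Fin N)) = selbergValue a b N := by
  induction N generalizing a with
  | zero =>
    have h : Set.Icc (0 : Fin 0 → ℝ) 1 = Set.univ :=
      Set.eq_univ_of_forall fun t => ⟨fun i => i.elim0, fun i => i.elim0⟩
    rw [selbergMoment, h, Measure.volume_pi_eq_dirac 0]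
    simp [selbergValue, selbergDensity, vandermondePowFour]
  | succ n ih =>
    induction a with
    | zero =>
      have hb : (b : ℝ) + 1 + 2 * n ≠ 0 := by positivity
      refine mul_left_cancel₀ hb ?_
      rw [selbergMoment_zero_mul, selbergValue_zero_mul, ih]
    | succ a iha =>
      have hp : ∏ j ∈ Finset.range (n + 1), ((a : ℝ) + b + 2 + 2 * (n + j)) ≠ 0 :=
        Finset.prod_ne_zero_iff.mpr fun j _ => by positivity
      refine mul_right_cancel₀ hp ?_
      rw [selbergMoment_succ_mul, selbergValue_succ_mul, iha]

/-- The Selberg-type integral evaluation underlying the normalization of the real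
quaternion induced spherical ensemble. -/
theorem selberg_integral_quaternion_induced_spherical (N n L : ℕ) (hN : 1 ≤ N) (hn : N ≤ n) :
    ∫ t in {t : Fin N → ℝ | ∀ i, t i ∈ Set.Icc (0:ℝ) 1},
        (∏ j : Fin N, (t j) ^ (2*L+1) * (1 - t j) ^ (2*(n-N)+1)) *
        ∏ j : Fin N, ∏ k : Fin N, (if j < k then (t k - t j) ^ 4 else 1) =
      ∏ j : Fin N,
        Real.Gamma (2*((L:ℝ)+(j:ℕ)+1)) * Real.Gamma (2*((n:ℝ)-N+(j:ℕ)+1)) *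
          Real.Gamma (2*((j:ℕ)+1)+1) /
        (Real.Gamma (2*((L:ℝ)+n+(j:ℕ)+1)) * Real.Gamma 3) := by
  have hcube : {t : Fin N → ℝ | ∀ i, t i ∈ Set.Icc (0:ℝ) 1} = Set.Icc 0 1 := by
    ext t
    simp [Set.mem_Icc, Pi.le_def, forall_and]
  have h := selbergMoment_empty (2 * L + 1) (2 * (n - N) + 1) N
  simp only [selbergMoment, Finset.prod_empty, one_mul, selbergDensity, vandermondePowFour] at h
  rw [hcube, h, selbergValue, Finset.prod_range]
  refine Finset.prod_congr rfl fun j _ => ?_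
  obtain ⟨d, rfl⟩ := Nat.exists_eq_add_of_le hn
  have e : 2 * L + 1 + (2 * (N + d - N) + 1) + 2 * (N + j) - 1 =
      2 * L + 2 * (N + d) + 2 * j + 1 := by omega
  rw [e, Nat.add_sub_cancel_left]
  have g (k : ℕ) (x : ℝ) (hx : x = k + 1) : Real.Gamma x = k.factorial := by
    rw [hx, Real.Gamma_nat_eq_factorial]
  rw [g (2 * L + 1 + 2 * j) _ (by push_cast; ring), g (2 * d + 1 + 2 * j) _ (by push_cast; ring),
    g (2 * j + 2) _ (by push_cast; ring),
    g (2 * L + 2 * (N + d) + 2 * j + 1) _ (by push_cast; ring), g 2 3 (by norm_num)]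
  norm_num
end
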